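/- arXiv:1404.6202 — 4 statements merged into one kernel-verified Lean document; each statement's English description precedes it below -/
import Mathlib

section
/- The closed Gårding cone is closed under addition: if x, y ∈ ℝ^n satisfy e_k(x) ≥ 0 and e_k(y) ≥ 0 for every k = 1,…,m, then e_k(x + y) ≥ 0 for every k = 1,…,m. -/
/-- The `k`-th elementary symmetric polynomial of the coordinates of `x ∈ ℝⁿ`
(with `esymm x 0 = 1`). -/
noncomputable def esymm {n : ℕ} (x : Fin n → ℝ) (k : ℕ) : ℝ :=
  ∑ S ∈ Finset.powersetCard k (Finset.univ : Finset (Fin n)), ∏ i ∈ S, x i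

namespace GC
open Finset Polynomial

set_option linter.unusedSectionVars false
set_option linter.unusedSimpArgs false

variable {ι : Type*} [DecidableEq ι]

noncomputable def E (s : Finset ι) (x : ι → ℝ) (k : ℕ) : ℝ :=
  ∑ S ∈ Finset.powersetCard k s, ∏ i ∈ S, x i

lemma E_zero (s : Finset ι) (x : ι → ℝ) : E s x 0 = 1 := by simp [E]

lemma E_insert {s : Finset ι} {a : ι} (h : a ∉ s) (x : ι → ℝ) (k : ℕ) :
    E (insert a s) x (k+1) = E s x (k+1) + x a * E s x k := by
  unfold E
  rw [Finset.powersetCard_succ_insert h, Finset.sum_union, Finset.sum_image, Finset.mul_sum]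
  · congr 1
    refine Finset.sum_congr rfl fun S hS => ?_
    rw [Finset.prod_insert]
    exact fun ha => h ((Finset.mem_powersetCard.1 hS).1 ha)
  · intro S hS T hT hST
    have h1 : a ∉ S := fun ha => h ((Finset.mem_powersetCard.1 hS).1 ha)
    have h2 : a ∉ T := fun ha => h ((Finset.mem_powersetCard.1 hT).1 ha)
    rw [← Finset.erase_insert h1, ← Finset.erase_insert h2]
    exact congrArg (fun U => Finset.erase U a) hST
  · rw [Finset.disjoint_left]
    intro S hS hS'
    obtain ⟨T, hT, rfl⟩ := Finset.mem_image.1 hS'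
    exact h ((Finset.mem_powersetCard.1 hS).1 (Finset.mem_insert_self a T))

lemma E_erase {s : Finset ι} {a : ι} (h : a ∈ s) (x : ι → ℝ) (k : ℕ) :
    E s x (k+1) = E (s.erase a) x (k+1) + x a * E (s.erase a) x k := by
  conv_lhs => rw [← Finset.insert_erase h]
  exact E_insert (Finset.notMem_erase a s) x k

lemma euler (s : Finset ι) (x : ι → ℝ) : ∀ k : ℕ,
    ∑ i ∈ s, x i * E (s.erase i) x k = (k+1) * E s x (k+1) := by
  induction s using Finset.induction_on with
  | empty => 
    intro k
    have : E (∅ : Finset ι) x (k+1) = 0 := by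
      unfold E
      rw [Finset.powersetCard_eq_empty.2 (by simp)]; simp
    simp [this]
  | insert a s ha ih =>
    intro k
    rw [Finset.sum_insert ha, Finset.erase_insert ha, E_insert ha]
    have hne : ∀ i ∈ s, (insert a s).erase i = insert a (s.erase i) := fun i hi =>
      Finset.erase_insert_of_ne (fun h => ha (h ▸ hi))
    have hn : ∀ i, a ∉ s.erase i := fun i h => ha (Finset.mem_of_mem_erase h)
    cases k with
    | zero =>
      have := ih 0
      simp only [E_zero] at this ⊢
      rw [this]; push_cast; ring
    | succ k =>
      have : ∑ i ∈ s, x i * E ((insert a s).erase i) x (k+1)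
          = ∑ i ∈ s, x i * E (s.erase i) x (k+1) + x a * ∑ i ∈ s, x i * E (s.erase i) x k := by
        rw [Finset.mul_sum, ← Finset.sum_add_distrib]
        refine Finset.sum_congr rfl fun i hi => ?_
        rw [hne i hi, E_insert (hn i)]; ring
      rw [this, ih, ih]; push_cast; ring

lemma laguerre (m : Multiset ℝ) (t : ℝ) : 
    let q := (m.map fun a => X - C a).prod
    q.eval t * (derivative (derivative q)).eval t ≤ (derivative q).eval t ^ 2 := by
  induction m using Multiset.induction_on with
  | empty => simp
  | cons a m ih =>
    simp only [Multiset.map_cons, Multiset.prod_cons] at ih ⊢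
    generalize (m.map fun a => X - C a).prod = s at ih
    simp only [derivative_mul, derivative_add, derivative_sub, derivative_X, derivative_C, eval_add, eval_mul,
      eval_sub, eval_X, eval_C, sub_zero, one_mul, eval_one, derivative_one, zero_mul, zero_add]
    nlinarith [mul_le_mul_of_nonneg_left ih (sq_nonneg (t - a)), sq_nonneg (eval t s)]

lemma laguerre_splits {p : ℝ[X]} (hp : p.Splits) (t : ℝ) :
    p.eval t * (derivative (derivative p)).eval t ≤ (derivative p).eval t ^ 2 := by
  have h := hp.eq_prod_roots
  have := laguerre p.roots t
  simp only at this
  rw [h]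
  generalize (p.roots.map fun a => X - C a).prod = s at this
  simp only [derivative_C_mul, eval_C_mul]
  nlinarith [mul_le_mul_of_nonneg_left this (sq_nonneg p.leadingCoeff)]

lemma splits_deriv {p : ℝ[X]} (hp : p.Splits) : (derivative p).Splits := by
  rw [splits_iff_card_roots] at hp ⊢
  have h1 := card_roots_le_derivative p
  have h2 := card_roots' (derivative p)
  have h3 := natDegree_derivative_le p
  omega

lemma coeff_newton {p : ℝ[X]} (hp : p.Splits) (j : ℕ) :
    p.coeff j * p.coeff (j+2) ≤ p.coeff (j+1) ^ 2 := by
  have hs : (derivative^[j] p).Splits := by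
    induction j with
    | zero => simpa
    | succ j ih => rw [Function.iterate_succ_apply']; exact splits_deriv ih
  have h := laguerre_splits hs 0
  rw [← Function.iterate_succ_apply' derivative, ← Function.iterate_succ_apply' derivative] at h
  simp only [← coeff_zero_eq_eval_zero, coeff_iterate_derivative, zero_add, Nat.descFactorial_self,
    nsmul_eq_mul, Nat.succ_eq_add_one, Nat.factorial_succ] at h
  push_cast at h
  have hf : (0:ℝ) < (j.factorial : ℝ) := by positivity
  rcases le_or_gt (p.coeff j * p.coeff (j+2)) 0 with h0 | h0
  · exact h0.trans (sq_nonneg _)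
  have h' : (p.coeff j * p.coeff (j+2)) * ((j:ℝ)+1+1) ≤ ((j:ℝ)+1) * p.coeff (j+1) ^ 2 := by
    have hc : (0:ℝ) < (j.factorial:ℝ)^2 * (j+1) := by positivity
    refine le_of_mul_le_mul_left ?_ hc
    rw [show j + 1 + 1 = j + 2 from rfl] at h
    linarith
  have hj : (0:ℝ) < (j:ℝ)+1 := by positivity
  refine le_of_mul_le_mul_left ?_ hj
  linarith

noncomputable def P (s : Finset ι) (x : ι → ℝ) : ℝ[X] := ∏ i ∈ s, (X + C (x i))

lemma P_coeff (s : Finset ι) (x : ι → ℝ) {k : ℕ} (h : k ≤ s.card) :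
    (P s x).coeff k = E s x (s.card - k) := Finset.prod_X_add_C_coeff s x h

lemma E_gt {s : Finset ι} (x : ι → ℝ) {k : ℕ} (h : s.card < k) : E s x k = 0 := by
  simp [E, Finset.powersetCard_eq_empty.2 h]

lemma newton (s : Finset ι) (x : ι → ℝ) (j : ℕ) :
    E s x j * E s x (j+2) ≤ E s x (j+1) ^ 2 := by
  rcases lt_or_ge s.card (j+2) with h | h
  · rw [E_gt x h]; simp [sq_nonneg]
  have hs : (P s x).Splits := by
    unfold P
    exact Splits.prod fun i _ => Splits.X_add_C _
  have := coeff_newton hs (s.card - (j+2))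
  rw [P_coeff s x (by omega), P_coeff s x (by omega), P_coeff s x (by omega),
    show s.card - (s.card - (j+2)) = j+2 by omega,
    show s.card - (s.card - (j+2) + 1) = j+1 by omega,
    show s.card - (s.card - (j+2) + 2) = j by omega] at this
  linarith

lemma erase_pos {s : Finset ι} {a : ι} (ha : a ∈ s) (x : ι → ℝ) {k : ℕ}
    (h : ∀ j ≤ k+1, 0 < E s x j) : ∀ j ≤ k, 0 < E (s.erase a) x j := by
  intro j
  induction j with
  | zero => intro _; simp [E_zero]
  | succ j ih =>
    intro hj
    have h0 := ih (by omega)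
    have h1 := h (j+1) (by omega)
    have h2 := h (j+2) (by omega)
    rw [E_erase ha] at h1 h2
    have hn := newton (s.erase a) x j
    by_contra! hc
    generalize E (s.erase a) x j = A at *
    change 0 < E (s.erase a) x (j+2) + _ at h2
    generalize E (s.erase a) x (j+1) = B at *
    generalize E (s.erase a) x (j+2) = D at *
    nlinarith [mul_pos h0 h2, mul_nonneg (neg_nonneg.2 hc) h1.le]

lemma key {x y a b c : ℝ} (hx : 0 < a + x) (hy : 0 < b + y) (hc : a + b ≤ c) :
    x * (a / (a+x)) + y * (b / (b+y)) ≤ (x+y) * (c / (c + (x+y))) := by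
  have hz : 0 < c + (x+y) := by linarith
  have e1 : x * (a / (a+x)) = x - x^2/(a+x) := by field_simp; ring
  have e2 : y * (b / (b+y)) = y - y^2/(b+y) := by field_simp; ring
  have e3 : (x+y) * (c / (c+(x+y))) = (x+y) - (x+y)^2/(c+(x+y)) := by field_simp; ring
  rw [e1, e2, e3]
  have h1 : (x+y)^2/(c+(x+y)) ≤ (x+y)^2/((a+x)+(b+y)) := by
    apply div_le_div_of_nonneg_left (sq_nonneg _) (by linarith) (by linarith)
  have h2 : (x+y)^2/((a+x)+(b+y)) ≤ x^2/(a+x) + y^2/(b+y) := by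
    rw [div_add_div _ _ hx.ne' hy.ne', div_le_div_iff₀ (by linarith) (by positivity)]
    nlinarith [sq_nonneg (x*(b+y) - y*(a+x))]
  linarith

lemma key' {x y A B A' B' A'' B'' : ℝ} (hB : 0 < B) (hB' : 0 < B') (hB'' : 0 < B'')
    (hx : 0 < A + x * B) (hy : 0 < A' + y * B') (hc : A / B + A' / B' ≤ A'' / B'') :
    x * A / (A + x * B) + y * A' / (A' + y * B') ≤ (x+y) * A'' / (A'' + (x+y) * B'') := by
  have f : ∀ x A B : ℝ, 0 < B → x * A / (A + x * B) = x * (A / B / (A / B + x)) := by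
    intro x A B hB
    rw [show A / B + x = (A + x * B) / B by field_simp, div_div_div_cancel_right₀ hB.ne', mul_div_assoc]
  have g : ∀ x A B : ℝ, 0 < B → 0 < A + x * B → 0 < A / B + x := by
    intro x A B hB h
    rw [show A / B + x = (A + x * B) / B by field_simp]
    positivity
  rw [f _ _ _ hB, f _ _ _ hB', f _ _ _ hB'']
  exact key (g _ _ _ hB hx) (g _ _ _ hB' hy) hc

lemma open_add (k : ℕ) : ∀ (s : Finset ι) (x y : ι → ℝ), (∀ j ≤ k+1, 0 < E s x j) →
    (∀ j ≤ k+1, 0 < E s y j) →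
    (E s x (k+1) / E s x k + E s y (k+1) / E s y k ≤ E s (x+y) (k+1) / E s (x+y) k) ∧
    ∀ j ≤ k+1, 0 < E s (x+y) j := by
  induction k with
  | zero =>
    intro s x y hx hy
    have e : E s (x+y) 1 = E s x 1 + E s y 1 := by
      have := euler s (x+y) 0
      have h1 := euler s x 0
      have h2 := euler s y 0
      simp only [E_zero, Pi.add_apply, mul_one, Finset.sum_add_distrib] at this h1 h2
      simp at this h1 h2
      linarith
    refine ⟨by simp [E_zero, e], ?_⟩
    intro j hj
    have : j = 0 ∨ j = 1 := by omega
    rcases this with rfl | rfl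
    · simp [E_zero]
    · rw [e]; exact add_pos (hx 1 le_rfl) (hy 1 le_rfl)
  | succ k ih =>
    intro s x y hx hy
    have hp := (ih s x y (fun j hj => hx j (by omega)) (fun j hj => hy j (by omega))).2
    have f : ∀ z : ι → ℝ, ((k:ℝ)+2) * (E s z (k+1+1) / E s z (k+1))
        = ∑ i ∈ s, z i * E (s.erase i) z (k+1) / E s z (k+1) := by
      intro z
      rw [← Finset.sum_div, euler]; push_cast; ring
    have main : E s x (k+1+1) / E s x (k+1) + E s y (k+1+1) / E s y (k+1)
        ≤ E s (x+y) (k+1+1) / E s (x+y) (k+1) := by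
      have hk : (0:ℝ) < (k:ℝ)+2 := by positivity
      refine le_of_mul_le_mul_left ?_ hk
      rw [mul_add, f, f, f, ← Finset.sum_add_distrib]
      refine Finset.sum_le_sum fun i hi => ?_
      have ex := erase_pos hi x hx
      have ey := erase_pos hi y hy
      obtain ⟨h1, h2⟩ := ih (s.erase i) x y ex ey
      have px := hx (k+1) (by omega)
      have py := hy (k+1) (by omega)
      rw [E_erase hi] at px py
      rw [E_erase hi x k, E_erase hi y k, E_erase hi (x+y) k]
      exact key' (ex k (by omega)) (ey k (by omega)) (h2 k (by omega)) px py h1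
    refine ⟨main, fun j hj => ?_⟩
    rcases Nat.lt_or_ge j (k+2) with h | h
    · exact hp j (by omega)
    · obtain rfl : j = k+1+1 := by omega
      have q := hp (k+1) le_rfl
      have : 0 < E s (x+y) (k+1+1) / E s (x+y) (k+1) :=
        lt_of_lt_of_le (add_pos (div_pos (hx _ le_rfl) (hx _ (by omega)))
          (div_pos (hy _ le_rfl) (hy _ (by omega)))) main
      exact (div_pos_iff_of_pos_right q).1 this

lemma P_natDegree (s : Finset ι) (x : ι → ℝ) : (P s x).natDegree = s.card := by
  unfold P
  rw [natDegree_prod_of_monic _ _ (fun i _ => monic_X_add_C _)]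
  simp

lemma P_shift (s : Finset ι) (x : ι → ℝ) (ε : ℝ) :
    P s (fun i => x i + ε) = taylor ε (P s x) := by
  unfold P
  simp only [taylor_apply, Polynomial.prod_comp, add_comp, X_comp, C_comp, C_add]
  refine Finset.prod_congr rfl fun i _ => by ring

lemma shift_pos (s : Finset ι) (x : ι → ℝ) {m : ℕ} (hm : m ≤ s.card)
    (h : ∀ j ≤ m, 0 ≤ E s x j) {ε : ℝ} (hε : 0 < ε) :
    ∀ j ≤ m, 0 < E s (fun i => x i + ε) j := by
  intro j hj
  have e : E s (fun i => x i + ε) j = (taylor ε (P s x)).coeff (s.card - j) := by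
    rw [← P_shift, P_coeff _ _ (by omega)]; congr 1; omega
  rw [e, taylor_coeff, hasseDeriv_apply, Polynomial.sum_def, eval_finsetSum]
  simp only [eval_monomial]
  have hmem : s.card ∈ (P s x).support := by
    rw [mem_support_iff, P_coeff _ _ le_rfl]; simp [E_zero]
  refine Finset.sum_pos' (fun i hi => ?_) ⟨s.card, hmem, ?_⟩
  · have hi' : i ≤ s.card := P_natDegree s x ▸ le_natDegree_of_mem_supp i hi
    rcases Nat.lt_or_ge i (s.card - j) with hl | hl
    · simp [Nat.choose_eq_zero_of_lt hl]
    · rw [P_coeff _ _ hi']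
      have := h (s.card - i) (by omega)
      positivity
  · rw [P_coeff _ _ le_rfl]
    have : 0 < (s.card).choose (s.card - j) := Nat.choose_pos (by omega)
    simp only [Nat.sub_self, E_zero, mul_one]
    positivity

lemma closed_add (s : Finset ι) (x y : ι → ℝ) {m : ℕ} (hm : m ≤ s.card)
    (hx : ∀ j ≤ m, 0 ≤ E s x j) (hy : ∀ j ≤ m, 0 ≤ E s y j) (j : ℕ) (hj : j ≤ m) :
    0 ≤ E s (x+y) j := by
  have hpos : ∀ ε : ℝ, 0 < ε → 0 ≤ E s ((fun i => x i + ε) + (fun i => y i + ε)) j := by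
    intro ε hε
    cases m with
    | zero => obtain rfl : j = 0 := by omega
              simp [E_zero]
    | succ m =>
      exact ((open_add m s _ _ (shift_pos s x hm hx hε) (shift_pos s y hm hy hε)).2 j hj).le
  have hc : Continuous fun ε : ℝ => E s ((fun i => x i + ε) + (fun i => y i + ε)) j := by
    unfold E
    simp only [Pi.add_apply]
    fun_prop
  have ht := (hc.tendsto 0).mono_left (nhdsWithin_le_nhds (s := Set.Ioi 0))
  have := ge_of_tendsto ht (Filter.eventually_of_mem self_mem_nhdsWithin fun ε hε => hpos ε hε)
  simpa [Pi.add_def] using this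

end GC

/-- The closed Gårding cone is closed under addition: if `x, y ∈ ℝⁿ` satisfy
`e_k(x) ≥ 0` and `e_k(y) ≥ 0` for every `k = 1,…,m`, then `e_k(x+y) ≥ 0` for every
`k = 1,…,m`. -/
theorem garding_cone_add {n m : ℕ} (hn : 1 ≤ n) (hm : 1 ≤ m) (hmn : m ≤ n)
    (x y : Fin n → ℝ)
    (hx : ∀ k, 1 ≤ k → k ≤ m → 0 ≤ esymm x k)
    (hy : ∀ k, 1 ≤ k → k ≤ m → 0 ≤ esymm y k) :
    ∀ k, 1 ≤ k → k ≤ m → 0 ≤ esymm (x + y) k := by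
  have key : ∀ z : Fin n → ℝ, (∀ k, 1 ≤ k → k ≤ m → 0 ≤ esymm z k) →
      ∀ k ≤ m, 0 ≤ GC.E Finset.univ z k := by
    intro z hz k hk
    rcases Nat.eq_zero_or_pos k with rfl | h
    · simp [GC.E_zero]
    · exact hz k h hk
  intro k _ hk
  exact GC.closed_add Finset.univ x y (by simpa using hmn) (key x hx) (key y hy) k hk
end

section
/- Superadditivity of e_m^{1/m} on the Gårding cone: if x, y ∈ ℝ^n satisfy e_k(x) ≥ 0 and e_k(y) ≥ 0 for every k = 1,…,m, then e_m(x + y)^{1/m} ≥ e_m(x)^{1/m} + e_m(y)^{1/m}, where t^{1/m} denotes the nonnegative real m-th root. -/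
open Polynomial in
/-- Laguerre inequality for real-rooted polynomials. -/
theorem laguerre_aux (f : ℝ[X]) (hf : f.Splits) (t : ℝ) :
    f.eval t * f.derivative.derivative.eval t ≤ (f.derivative.eval t) ^ 2 := by
  have key : ∀ s : Multiset ℝ,
      ((s.map fun r => X - C r).prod).eval t *
        ((s.map fun r => X - C r).prod).derivative.derivative.eval t ≤
      (((s.map fun r => X - C r).prod).derivative.eval t) ^ 2 := by
    intro s
    induction s using Multiset.induction_on with
    | empty => simp
    | cons c s ih =>
      simp only [Multiset.map_cons, Multiset.prod_cons]
      generalize (s.map fun r => X - C r).prod = g at ih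
      simp only [derivative_mul, derivative_add, derivative_sub, derivative_X, derivative_C,
        eval_add, eval_mul, eval_sub, eval_X, eval_C, sub_zero, one_mul]
      nlinarith [sq_nonneg (g.eval t), mul_nonneg (sq_nonneg (t - c)) (sub_nonneg.2 ih)]
  have h := key f.roots
  have e := hf.eq_prod_roots
  generalize (f.roots.map fun r => X - C r).prod = g at h e
  rw [e]
  simp only [derivative_mul, derivative_C, zero_mul, zero_add, eval_mul, eval_C]
  nlinarith [mul_nonneg (sq_nonneg f.leadingCoeff) (sub_nonneg.2 h)]

open Polynomial in
theorem splits_derivative_aux (f : ℝ[X]) (hf : f.Splits) : f.derivative.Splits := by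
  rw [splits_iff_card_roots] at hf ⊢
  have h1 := card_roots_le_derivative f
  have h2 := card_roots' f.derivative
  by_cases h0 : f.natDegree = 0
  · have := natDegree_derivative_le f
    omega
  · have := natDegree_derivative_lt h0
    omega

/-- Elementary symmetric polynomial over a finset. -/
noncomputable def EE {n : ℕ} (s : Finset (Fin n)) (x : Fin n → ℝ) (k : ℕ) : ℝ :=
  ∑ S ∈ Finset.powersetCard k s, ∏ i ∈ S, x i

theorem EE_zero {n : ℕ} (s : Finset (Fin n)) (x : Fin n → ℝ) : EE s x 0 = 1 := by
  simp [EE]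

theorem EE_insert {n : ℕ} (s : Finset (Fin n)) (x : Fin n → ℝ) (i : Fin n) (hi : i ∉ s) (k : ℕ) :
    EE (insert i s) x (k + 1) = EE s x (k + 1) + x i * EE s x k := by
  unfold EE
  rw [← Nat.succ_eq_add_one, Finset.powersetCard_succ_insert hi, Finset.sum_union, Finset.sum_image,
    Finset.mul_sum]
  · congr 1
    apply Finset.sum_congr rfl
    intro S hS
    rw [Finset.prod_insert]
    exact fun h => hi ((Finset.mem_powersetCard.1 hS).1 h)
  · intro A hA B hB hAB
    have hA' : i ∉ A := fun h => hi ((Finset.mem_powersetCard.1 hA).1 h)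
    have hB' : i ∉ B := fun h => hi ((Finset.mem_powersetCard.1 hB).1 h)
    rw [← Finset.erase_insert hA', ← Finset.erase_insert hB']
    exact congrArg (fun T => T.erase i) hAB
  · rw [Finset.disjoint_left]
    intro A hA hB
    obtain ⟨B, hB, rfl⟩ := Finset.mem_image.1 hB
    exact hi ((Finset.mem_powersetCard.1 hA).1 (Finset.mem_insert_self _ _))

theorem EE_erase {n : ℕ} (s : Finset (Fin n)) (x : Fin n → ℝ) (i : Fin n) (hi : i ∈ s) (k : ℕ) :
    EE s x (k + 1) = EE (s.erase i) x (k + 1) + x i * EE (s.erase i) x k := by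
  conv_lhs => rw [← Finset.insert_erase hi]
  exact EE_insert _ _ _ (by simp) _

theorem EE_empty {n : ℕ} (x : Fin n → ℝ) (k : ℕ) : EE (∅ : Finset (Fin n)) x (k + 1) = 0 := by
  unfold EE
  rw [Finset.powersetCard_eq_empty.2 (by simp)]
  simp

theorem EE_euler {n : ℕ} (s : Finset (Fin n)) (x : Fin n → ℝ) (k : ℕ) :
    ∑ i ∈ s, x i * EE (s.erase i) x k = (k + 1) * EE s x (k + 1) := by
  induction s using Finset.induction_on generalizing k with
  | empty => simp [EE_empty]
  | insert a s ha ih =>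
    rw [Finset.sum_insert ha, Finset.erase_insert ha, EE_insert _ _ _ ha]
    have e : ∀ i ∈ s, (insert a s).erase i = insert a (s.erase i) := by
      intro i hi
      rw [Finset.erase_insert_of_ne]
      rintro rfl
      exact ha hi
    cases k with
    | zero =>
      simp only [EE_zero]
      have := ih 0
      simp only [EE_zero] at this
      rw [this]; push_cast; ring
    | succ k =>
      have : ∑ i ∈ s, x i * EE ((insert a s).erase i) x (k + 1) =
          ∑ i ∈ s, x i * EE (s.erase i) x (k + 1) + x a * ∑ i ∈ s, x i * EE (s.erase i) x k := by
        rw [Finset.mul_sum, ← Finset.sum_add_distrib]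
        apply Finset.sum_congr rfl
        intro i hi
        rw [e i hi, EE_insert _ _ _ (by simp [ha])]
        ring
      rw [this, ih, ih]; push_cast; ring

theorem EE_eq_zero {n : ℕ} (s : Finset (Fin n)) (x : Fin n → ℝ) (k : ℕ) (h : s.card < k) :
    EE s x k = 0 := by
  unfold EE
  rw [Finset.powersetCard_eq_empty.2 h]
  simp

open Polynomial in
theorem EE_coeff {n : ℕ} (s : Finset (Fin n)) (x : Fin n → ℝ) (k : ℕ) (h : k ≤ s.card) :
    (∏ i ∈ s, (X + C (x i))).coeff (s.card - k) = EE s x k := by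
  rw [Finset.prod_X_add_C_coeff _ _ (by omega)]
  unfold EE
  congr 2
  omega

open Polynomial in
/-- Weak Newton inequality. -/
theorem EE_newton {n : ℕ} (s : Finset (Fin n)) (x : Fin n → ℝ) (k : ℕ) :
    EE s x k * EE s x (k + 2) ≤ EE s x (k + 1) ^ 2 := by
  by_cases hk : s.card < k + 2
  · rw [EE_eq_zero s x (k + 2) hk]; simp only [mul_zero]; positivity
  push Not at hk
  obtain ⟨d, hd⟩ := Nat.exists_eq_add_of_le hk
  set f : ℝ[X] := ∏ i ∈ s, (X + C (x i)) with hf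
  have hs : f.Splits := by
    rw [hf]
    exact Splits.prod fun i _ => Splits.X_add_C _
  have hs' : ∀ j, (derivative^[j] f).Splits := by
    intro j
    induction j with
    | zero => simpa using hs
    | succ j ih =>
      rw [Function.iterate_succ_apply']
      exact splits_derivative_aux _ ih
  have h := laguerre_aux _ (hs' d) 0
  rw [← Function.iterate_succ_apply' derivative, ← Function.iterate_succ_apply' derivative,
    ← coeff_zero_eq_eval_zero, ← coeff_zero_eq_eval_zero, ← coeff_zero_eq_eval_zero,
    coeff_iterate_derivative, coeff_iterate_derivative, coeff_iterate_derivative] at h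
  have c0 : f.coeff (0 + d) = EE s x (k + 2) := by
    rw [← EE_coeff s x (k + 2) (by omega)]; congr 1; omega
  have c1 : f.coeff (0 + d.succ) = EE s x (k + 1) := by
    rw [← EE_coeff s x (k + 1) (by omega)]; congr 1; omega
  have c2 : f.coeff (0 + d.succ.succ) = EE s x k := by
    rw [← EE_coeff s x k (by omega)]; congr 1; omega
  rw [c0, c1, c2] at h
  simp only [zero_add, Nat.descFactorial_self, nsmul_eq_mul, Nat.factorial_succ,
    Nat.succ_eq_add_one] at h
  push_cast at h
  set F : ℝ := (d.factorial : ℝ) with hF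
  have hFp : 0 < F := by positivity
  have h2 : (F ^ 2 * (d + 1)) * ((d + 2) * (EE s x k * EE s x (k + 2))) ≤
      (F ^ 2 * (d + 1)) * ((d + 1) * EE s x (k + 1) ^ 2) := by
    nlinarith [h]
  have h3 := le_of_mul_le_mul_left h2 (by positivity)
  have hd0 : (0 : ℝ) ≤ d := by positivity
  by_contra hc
  push Not at hc
  nlinarith [sq_nonneg (EE s x (k + 1)), mul_nonneg hd0 (sub_nonneg.2 hc.le)]

theorem EE_cone_erase {n : ℕ} (s : Finset (Fin n)) (x : Fin n → ℝ) (i : Fin n) (hi : i ∈ s)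
    (k : ℕ) (h : ∀ j ≤ k + 1, 0 < EE s x j) : ∀ j ≤ k, 0 < EE (s.erase i) x j := by
  induction k with
  | zero =>
    intro j hj
    obtain rfl : j = 0 := by omega
    rw [EE_zero]; norm_num
  | succ k ih =>
    have ih' := ih fun j hj => h j (by omega)
    intro j hj
    rcases Nat.lt_or_ge j (k + 1) with hlt | hge
    · exact ih' j (by omega)
    obtain rfl : j = k + 1 := by omega
    have p0 := ih' k le_rfl
    have e1 := h (k + 1) (by omega)
    have e2 := h (k + 2) (by omega)
    rw [EE_erase s x i hi] at e1 e2
    have nw := EE_newton (s.erase i) x k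
    by_contra hc
    push Not at hc
    generalize EE (s.erase i) x k = a at *
    generalize EE (s.erase i) x (k + 1) = b at *
    generalize EE (s.erase i) x (k + 2) = c at *
    have t1 : 0 ≤ (b + x i * a) * (-b) := mul_nonneg e1.le (by linarith)
    have t2 : 0 < (c + x i * b) * a := mul_pos e2 p0
    nlinarith

theorem scalar_aux {x y u v w : ℝ} (hu : 0 < u + x) (hv : 0 < v + y) (hw : u + v ≤ w) :
    x * u / (u + x) + y * v / (v + y) ≤ (x + y) * w / (w + (x + y)) := by
  have e1 : x * u / (u + x) = x - x ^ 2 / (u + x) := by field_simp; ring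
  have e2 : y * v / (v + y) = y - y ^ 2 / (v + y) := by field_simp; ring
  have h3 : 0 < w + (x + y) := by linarith
  have e3 : (x + y) * w / (w + (x + y)) = (x + y) - (x + y) ^ 2 / (w + (x + y)) := by
    field_simp; ring
  rw [e1, e2, e3]
  have h4 : (x + y) ^ 2 / (w + (x + y)) ≤ (x + y) ^ 2 / ((u + x) + (v + y)) := by
    apply div_le_div_of_nonneg_left (sq_nonneg _) (by linarith) (by linarith)
  have h5 : (x + y) ^ 2 / ((u + x) + (v + y)) ≤ x ^ 2 / (u + x) + y ^ 2 / (v + y) := by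
    generalize u + x = p at *
    generalize v + y = q at *
    rw [div_add_div _ _ hu.ne' hv.ne', div_le_div_iff₀ (by positivity) (by positivity)]
    nlinarith [sq_nonneg (x * q - y * p), mul_pos hu hv]
  linarith

theorem EE_superadd {n : ℕ} (k : ℕ) : ∀ (s : Finset (Fin n)) (x y : Fin n → ℝ),
    (∀ j ≤ k + 1, 0 < EE s x j) → (∀ j ≤ k + 1, 0 < EE s y j) →
    (∀ j ≤ k + 1, 0 < EE s (x + y) j) ∧
    EE s x (k + 1) / EE s x k + EE s y (k + 1) / EE s y k ≤
      EE s (x + y) (k + 1) / EE s (x + y) k := by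
  induction k with
  | zero =>
    intro s x y hx hy
    have e : ∀ z : Fin n → ℝ, EE s z 1 = ∑ i ∈ s, z i := by
      intro z
      have := EE_euler s z 0
      simp only [EE_zero] at this
      simpa using this.symm
    have a : EE s (x + y) 1 = EE s x 1 + EE s y 1 := by
      simp only [e, Pi.add_apply, Finset.sum_add_distrib]
    constructor
    · intro j hj
      have h1 := hx 1 (by omega)
      have h2 := hy 1 (by omega)
      rcases Nat.lt_or_ge j 1 with h | h
      · obtain rfl : j = 0 := by omega
        rw [EE_zero]; norm_num
      · obtain rfl : j = 1 := by omega
        rw [a]; linarith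
    · simp [EE_zero, a]
  | succ k ih =>
    intro s x y hx hy
    obtain ⟨hpos, -⟩ := ih s x y (fun j hj => hx j (by omega)) (fun j hj => hy j (by omega))
    have form : ∀ z : Fin n → ℝ, (∀ j ≤ k + 1, 0 < EE s z j) →
        (∀ i ∈ s, 0 < EE (s.erase i) z k) →
        ∀ i ∈ s, 0 < EE (s.erase i) z (k + 1) / EE (s.erase i) z k + z i ∧
          z i * EE (s.erase i) z (k + 1) / EE s z (k + 1) =
          z i * (EE (s.erase i) z (k + 1) / EE (s.erase i) z k) /
            (EE (s.erase i) z (k + 1) / EE (s.erase i) z k + z i) := by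
      intro z hz hz' i hi
      have h1 := hz (k + 1) le_rfl
      have h2 := hz' i hi
      have e := EE_erase s z i hi k
      have e' : EE (s.erase i) z (k + 1) / EE (s.erase i) z k + z i =
          EE s z (k + 1) / EE (s.erase i) z k := by
        rw [e]; field_simp
      rw [e']
      refine ⟨by positivity, ?_⟩
      field_simp
    have ex := fun i hi => EE_cone_erase s x i hi (k + 1) hx
    have ey := fun i hi => EE_cone_erase s y i hi (k + 1) hy
    have hi' := fun i hi => ih (s.erase i) x y (ex i hi) (ey i hi)
    have main : ((k + 1 : ℕ) + 1 : ℝ) * (EE s x (k + 2) / EE s x (k + 1)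
        + EE s y (k + 2) / EE s y (k + 1)) ≤
        ((k + 1 : ℕ) + 1 : ℝ) * (EE s (x + y) (k + 2) / EE s (x + y) (k + 1)) := by
      rw [mul_add, ← mul_div_assoc, ← mul_div_assoc, ← mul_div_assoc, ← EE_euler, ← EE_euler,
        ← EE_euler, Finset.sum_div, Finset.sum_div, Finset.sum_div, ← Finset.sum_add_distrib]
      apply Finset.sum_le_sum
      intro i hi
      obtain ⟨px, qx⟩ := form x (fun j hj => hx j (by omega))
        (fun i hi => ex i hi k (by omega)) i hi
      obtain ⟨py, qy⟩ := form y (fun j hj => hy j (by omega))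
        (fun i hi => ey i hi k (by omega)) i hi
      obtain ⟨pz, qz⟩ := form (x + y) hpos (fun i hi => (hi' i hi).1 k (by omega)) i hi
      rw [qx, qy, qz]
      exact scalar_aux px py (hi' i hi).2
    have main' := le_of_mul_le_mul_left main (by positivity)
    refine ⟨?_, main'⟩
    intro j hj
    rcases Nat.lt_or_ge j (k + 2) with h | h
    · exact hpos j (by omega)
    · obtain rfl : j = k + 2 := by omega
      have a1 := hx (k + 2) (by omega)
      have a2 := hx (k + 1) (by omega)
      have b1 := hy (k + 2) (by omega)
      have b2 := hy (k + 1) (by omega)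
      have c2 := hpos (k + 1) (by omega)
      have : 0 < EE s (x + y) (k + 2) / EE s (x + y) (k + 1) :=
        lt_of_lt_of_le (by positivity) main'
      exact (div_pos_iff_of_pos_right c2).1 this

theorem mahler_aux (m : ℕ) (hm : 1 ≤ m) (a b c : ℕ → ℝ) (ha : ∀ i < m, 0 < a i)
    (hb : ∀ i < m, 0 < b i) (hc : ∀ i < m, a i + b i ≤ c i) :
    (∏ i ∈ Finset.range m, a i) ^ ((1 : ℝ) / m) + (∏ i ∈ Finset.range m, b i) ^ ((1 : ℝ) / m) ≤
      (∏ i ∈ Finset.range m, c i) ^ ((1 : ℝ) / m) := by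
  have hm0 : (0 : ℝ) < m := by exact_mod_cast hm
  have hcp : ∀ i < m, 0 < c i := fun i hi => by linarith [ha i hi, hb i hi, hc i hi]
  have key : ∀ z : ℕ → ℝ, (∀ i < m, 0 < z i) →
      (∏ i ∈ Finset.range m, z i) ^ ((1 : ℝ) / m) ≤
      (∑ i ∈ Finset.range m, (1 : ℝ) / m * (z i / c i)) *
        (∏ i ∈ Finset.range m, c i) ^ ((1 : ℝ) / m) := by
    intro z hz
    have := Real.geom_mean_le_arith_mean_weighted (Finset.range m) (fun _ => (1 : ℝ) / m)
      (fun i => z i / c i) (fun _ _ => by positivity) (by simp; field_simp)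
      (fun i hi => (div_pos (hz i (Finset.mem_range.1 hi)) (hcp i (Finset.mem_range.1 hi))).le)
    rw [Real.finsetProd_rpow _ _ (fun i hi => (div_pos (hz i (Finset.mem_range.1 hi))
      (hcp i (Finset.mem_range.1 hi))).le), Finset.prod_div_distrib,
      Real.div_rpow (Finset.prod_nonneg fun i hi => (hz i (Finset.mem_range.1 hi)).le)
        (Finset.prod_nonneg fun i hi => (hcp i (Finset.mem_range.1 hi)).le)] at this
    rwa [div_le_iff₀] at this
    exact Real.rpow_pos_of_pos (Finset.prod_pos fun i hi => hcp i (Finset.mem_range.1 hi)) _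
  have k1 := key a ha
  have k2 := key b hb
  have hP : 0 ≤ (∏ i ∈ Finset.range m, c i) ^ ((1 : ℝ) / m) :=
    Real.rpow_nonneg (Finset.prod_nonneg fun i hi => (hcp i (Finset.mem_range.1 hi)).le) _
  have hs : (∑ i ∈ Finset.range m, (1 : ℝ) / m * (a i / c i)) +
      (∑ i ∈ Finset.range m, (1 : ℝ) / m * (b i / c i)) ≤ 1 := by
    rw [← Finset.sum_add_distrib]
    calc _ ≤ ∑ i ∈ Finset.range m, (1 : ℝ) / m := by
          apply Finset.sum_le_sum
          intro i hi
          have hi := Finset.mem_range.1 hi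
          rw [← mul_add, ← add_div]
          have : (a i + b i) / c i ≤ 1 := (div_le_one (hcp i hi)).2 (hc i hi)
          exact mul_le_of_le_one_right (by positivity) this
      _ = 1 := by simp; field_simp
  nlinarith [mul_le_mul_of_nonneg_right hs hP]

theorem EE_root_open {n m : ℕ} (hm : 1 ≤ m) (s : Finset (Fin n)) (x y : Fin n → ℝ)
    (hx : ∀ j ≤ m, 0 < EE s x j) (hy : ∀ j ≤ m, 0 < EE s y j) :
    EE s x m ^ ((1 : ℝ) / m) + EE s y m ^ ((1 : ℝ) / m) ≤ EE s (x + y) m ^ ((1 : ℝ) / m) := by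
  have tel : ∀ z : Fin n → ℝ, (∀ j ≤ m, 0 < EE s z j) →
      ∏ i ∈ Finset.range m, EE s z (i + 1) / EE s z i = EE s z m := by
    intro z hz
    have : ∀ l ≤ m, ∏ i ∈ Finset.range l, EE s z (i + 1) / EE s z i = EE s z l := by
      intro l
      induction l with
      | zero => simp [EE_zero]
      | succ l ih =>
        intro hl
        rw [Finset.prod_range_succ, ih (by omega)]
        have := hz l (by omega)
        field_simp
    exact this m le_rfl
  have hz : ∀ j ≤ m, 0 < EE s (x + y) j := by
    obtain ⟨k, rfl⟩ := Nat.exists_eq_add_of_le' hm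
    exact (EE_superadd k s x y hx hy).1
  rw [← tel x hx, ← tel y hy, ← tel _ hz]
  apply mahler_aux m hm
  · intro i hi
    exact div_pos (hx _ (by omega)) (hx _ (by omega))
  · intro i hi
    exact div_pos (hy _ (by omega)) (hy _ (by omega))
  · intro i hi
    exact (EE_superadd i s x y (fun j hj => hx j (by omega)) (fun j hj => hy j (by omega))).2

open Polynomial in
theorem EE_shift_pos {n m : ℕ} (s : Finset (Fin n)) (hms : m ≤ s.card) (x : Fin n → ℝ)
    (hx : ∀ k ≤ m, 0 ≤ EE s x k) (ε : ℝ) (hε : 0 < ε) :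
    ∀ k ≤ m, 0 < EE s (x + fun _ => ε) k := by
  intro k hk
  rw [← EE_coeff s _ k (by omega)]
  have e : ∏ i ∈ s, (X + C ((x + fun _ => ε : Fin n → ℝ) i)) =
      taylor ε (∏ i ∈ s, (X + C (x i))) := by
    have h : taylor ε (∏ i ∈ s, (X + C (x i))) = ∏ i ∈ s, taylor ε (X + C (x i)) :=
      map_prod (taylorAlgHom ε) _ _
    rw [h]
    apply Finset.prod_congr rfl
    intro i _
    simp only [map_add, taylor_X, taylor_C, Pi.add_apply]
    ring
  rw [e, taylor_coeff]
  set f : ℝ[X] := ∏ i ∈ s, (X + C (x i)) with hf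
  have hdeg : (hasseDeriv (s.card - k) f).natDegree < k + 1 := by
    have := natDegree_hasseDeriv_le f (s.card - k)
    have h2 : f.natDegree = s.card := by
      rw [hf, natDegree_prod_of_monic _ _ fun i _ => monic_X_add_C _]
      simp
    omega
  rw [eval_eq_sum_range' hdeg]
  have co : ∀ i ≤ k, f.coeff (i + (s.card - k)) = EE s x (k - i) := by
    intro i hi
    rw [← EE_coeff s x (k - i) (by omega)]
    congr 1; omega
  apply Finset.sum_pos'
  · intro i hi
    have hi := Finset.mem_range.1 hi
    rw [hasseDeriv_coeff, co i (by omega)]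
    have := hx (k - i) (by omega)
    positivity
  · refine ⟨k, by simp, ?_⟩
    rw [hasseDeriv_coeff, co k le_rfl]
    simp only [Nat.sub_self, EE_zero]
    have : 0 < (k + (s.card - k)).choose (s.card - k) := Nat.choose_pos (by omega)
    positivity

theorem EE_continuous {n : ℕ} (s : Finset (Fin n)) (k : ℕ) :
    Continuous fun x : Fin n → ℝ => EE s x k := by
  unfold EE
  fun_prop

/-- Superadditivity of `e_m^{1/m}` on the closed Gårding cone: if `x, y ∈ ℝⁿ` satisfy
`e_k(x) ≥ 0` and `e_k(y) ≥ 0` for every `k = 1,…,m`, then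
`e_m(x+y)^{1/m} ≥ e_m(x)^{1/m} + e_m(y)^{1/m}` (nonnegative real `m`-th roots). -/
theorem esymm_root_superadditive {n m : ℕ} (hn : 1 ≤ n) (hm : 1 ≤ m) (hmn : m ≤ n)
    (x y : Fin n → ℝ)
    (hx : ∀ k, 1 ≤ k → k ≤ m → 0 ≤ esymm x k)
    (hy : ∀ k, 1 ≤ k → k ≤ m → 0 ≤ esymm y k) :
    esymm (x + y) m ^ ((1 : ℝ) / m)
      ≥ esymm x m ^ ((1 : ℝ) / m) + esymm y m ^ ((1 : ℝ) / m) := by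
  have nn : ∀ z : Fin n → ℝ, (∀ k, 1 ≤ k → k ≤ m → 0 ≤ esymm z k) →
      ∀ k ≤ m, 0 ≤ EE Finset.univ z k := by
    intro z hz k hk
    rcases Nat.eq_zero_or_pos k with rfl | h
    · rw [EE_zero]; norm_num
    · exact hz k h hk
  change EE Finset.univ x m ^ ((1 : ℝ) / m) + EE Finset.univ y m ^ ((1 : ℝ) / m) ≤
    EE Finset.univ (x + y) m ^ ((1 : ℝ) / m)
  have hc : m ≤ (Finset.univ : Finset (Fin n)).card := by simpa using hmn
  have hineq : ∀ ε : ℝ, 0 < ε →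
      EE Finset.univ (x + fun _ => ε) m ^ ((1 : ℝ) / m) +
        EE Finset.univ (y + fun _ => ε) m ^ ((1 : ℝ) / m) ≤
      EE Finset.univ ((x + fun _ => ε) + (y + fun _ => ε)) m ^ ((1 : ℝ) / m) := fun ε hε =>
    EE_root_open hm _ _ _ (EE_shift_pos _ hc x (nn x hx) ε hε)
      (EE_shift_pos _ hc y (nn y hy) ε hε)
  have hp : (0 : ℝ) ≤ (1 : ℝ) / m := by positivity
  have lim : ∀ g : ℝ → (Fin n → ℝ), Continuous g →
      Filter.Tendsto (fun ε => EE Finset.univ (g ε) m ^ ((1 : ℝ) / m))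
        (nhdsWithin 0 (Set.Ioi 0)) (nhds (EE Finset.univ (g 0) m ^ ((1 : ℝ) / m))) := by
    intro g hg
    have : Continuous fun ε => EE Finset.univ (g ε) m ^ ((1 : ℝ) / m) :=
      ((EE_continuous Finset.univ m).comp hg).rpow_const fun _ => Or.inr hp
    exact (this.tendsto 0).mono_left nhdsWithin_le_nhds
  have l1 := lim (fun ε => x + fun _ => ε) (by fun_prop)
  have l2 := lim (fun ε => y + fun _ => ε) (by fun_prop)
  have l3 := lim (fun ε => (x + fun _ => ε) + (y + fun _ => ε)) (by fun_prop)
  have z0 : (fun _ : Fin n => (0 : ℝ)) = 0 := rfl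
  have := le_of_tendsto_of_tendsto (l1.add l2) l3
    (Filter.eventually_of_mem self_mem_nhdsWithin fun ε hε => hineq ε hε)
  simpa only [z0, add_zero] using this
end

section
/- Mixed Gårding inequality for vectors: let x^1,…,x^m ∈ ℝ^n each satisfy e_k(x^j) ≥ 0 for every k = 1,…,m. Define the polarized form Ẽ_m(x^1,…,x^m) := (1/m!) Σ_{∅≠T⊆{1,…,m}} (−1)^{m−|T|} e_m(Σ_{j∈T} x^j). Then Ẽ_m(x^1,…,x^m) ≥ 0 and Ẽ_m(x^1,…,x^m)^m ≥ e_m(x^1) · e_m(x^2) ⋯ e_m(x^m). -/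
/-- The full polarization of `e_m`:
`Ẽ_m(x¹,…,xᵐ) = (1/m!) ∑_{∅ ≠ T ⊆ {1,…,m}} (−1)^{m−|T|} e_m(∑_{j∈T} xʲ)`. -/
noncomputable def polarizedEsymm {n m : ℕ} (x : Fin m → (Fin n → ℝ)) : ℝ :=
  (m.factorial : ℝ)⁻¹ *
    ∑ T ∈ (Finset.univ : Finset (Finset (Fin m))).filter (fun T => T ≠ ∅),
      (-1 : ℝ) ^ (m - T.card) * esymm (∑ j ∈ T, x j) m

open Polynomial in
/-- Gauss–Lucas type fact. -/
lemma derivative_eval_ne_zero_of_roots_below (P : ℂ[X]) (hdeg : 1 ≤ P.natDegree) (z : ℂ)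
    (h : ∀ r, P.eval r = 0 → r.im < z.im) : P.derivative.eval z ≠ 0 := by
  have hz : P.eval z ≠ 0 := fun h0 => lt_irrefl _ (h z h0)
  have hs : P.Splits := IsAlgClosed.splits P
  rw [hs.eval_derivative_eq_eval_mul_sum hz]
  refine mul_ne_zero hz ?_
  have hP : P ≠ 0 := by rintro rfl; simp at hdeg
  have key : ∀ s : Multiset ℂ, (∀ r ∈ s, r.im < z.im) → s ≠ 0 →
      ((s.map fun r => 1 / (z - r)).sum).im < 0 := by
    intro s
    induction s using Multiset.induction_on with
    | empty => intro _ h; exact absurd rfl h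
    | cons a s ih =>
      intro hr _
      have ha : (1 / (z - a)).im < 0 := by
        have h1 : a.im < z.im := hr a (by simp)
        rw [one_div, Complex.inv_im]
        apply div_neg_of_neg_of_pos
        · simp; linarith
        · apply Complex.normSq_pos.mpr
          intro h0
          have := congrArg Complex.im h0
          simp at this; linarith
      rw [Multiset.map_cons, Multiset.sum_cons, Complex.add_im]
      by_cases hs0 : s = 0
      · subst hs0; simpa using ha
      · have := ih (fun r hr' => hr r (by simp [hr'])) hs0
        linarith
  intro h0
  have := key P.roots (fun r hr => h r ((mem_roots hP).1 hr)) (by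
    intro h1
    have := hs.natDegree_eq_card_roots
    rw [h1] at this; simp at this; omega)
  rw [h0] at this
  simp at this

lemma multiset_amgm (s : Multiset ℝ) (h : ∀ r ∈ s, 0 < r) :
    s.prod * (Multiset.card s : ℝ) ^ (Multiset.card s) ≤ s.sum ^ (Multiset.card s) := by
  classical
  obtain ⟨k, hk⟩ : ∃ k, Multiset.card s = k := ⟨_, rfl⟩
  rw [hk]
  rcases Nat.eq_zero_or_pos k with h0 | hkpos
  · subst h0; rw [Multiset.card_eq_zero] at hk; subst hk; simp
  have hkR : (0:ℝ) < k := by exact_mod_cast hkpos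
  have hmem : ∀ i : s.ToType, 0 < (i.1 : ℝ) := fun i => h _ (Multiset.coe_mem)
  have h1 := Real.geom_mean_le_arith_mean_weighted (Finset.univ : Finset s.ToType)
    (fun _ => (1 / k : ℝ)) (fun i => i.1) (fun _ _ => by positivity)
    (by simp [hk, hkR.ne']) (fun i _ => (hmem i).le)
  have hsum : ∑ i : s.ToType, (i.1:ℝ) = s.sum := by
    rw [Finset.sum, Multiset.map_univ_coe]
  have hprod : ∏ i : s.ToType, (i.1:ℝ) = s.prod := by
    rw [Finset.prod, Multiset.map_univ_coe]
  rw [← Finset.mul_sum, hsum] at h1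
  have h2 := pow_le_pow_left₀ (Finset.prod_nonneg fun i _ => Real.rpow_nonneg (hmem i).le _) h1 k
  rw [← Finset.prod_pow] at h2
  have h3 : ∀ i : s.ToType, ((i.1:ℝ) ^ (1 / k : ℝ)) ^ k = i.1 := fun i => by
    rw [one_div]; exact Real.rpow_inv_natCast_pow (hmem i).le hkpos.ne'
  rw [Finset.prod_congr rfl (fun i _ => h3 i), hprod, mul_pow, one_div, inv_pow] at h2
  calc s.prod * (k:ℝ)^k ≤ (((k:ℝ)^k)⁻¹ * s.sum^k) * (k:ℝ)^k := by gcongr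
    _ = s.sum ^ k := by field_simp

section line
open Polynomial
variable {V : Type*} [AddCommGroup V] [Module ℂ V]

/-- The polynomial `t ↦ M(v + t a, …, v + t a)`. -/
noncomputable def linePoly {m : ℕ} (M : MultilinearMap ℂ (fun _ : Fin m => V) ℂ) (v a : V) : ℂ[X] :=
  ∑ s : Finset (Fin m), C (M (s.piecewise (fun _ => a) (fun _ => v))) * X ^ s.card

lemma linePoly_eval {m : ℕ} (M : MultilinearMap ℂ (fun _ : Fin m => V) ℂ) (v a : V) (t : ℂ) :
    (linePoly M v a).eval t = M (fun _ => v + t • a) := by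
  have h : (fun _ : Fin m => v + t • a) = (fun _ => t • a) + (fun _ => v) := by
    funext i; simp [add_comm]
  rw [h, M.map_add_univ, linePoly, eval_finsetSum]
  refine Finset.sum_congr rfl fun s _ => ?_
  have := M.map_piecewise_smul (fun _ => t) (s.piecewise (fun _ => a) (fun _ => v)) s
  have h2 : s.piecewise (fun i => t • (s.piecewise (fun _ => a) (fun _ => v) : Fin m → V) i)
      (s.piecewise (fun _ => a) (fun _ => v)) = s.piecewise (fun _ => t • a) (fun _ => v) := by
    funext i
    by_cases hi : i ∈ s
    · rw [Finset.piecewise_eq_of_mem _ _ _ hi, Finset.piecewise_eq_of_mem _ _ _ hi,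
        Finset.piecewise_eq_of_mem _ _ _ hi]
    · rw [Finset.piecewise_eq_of_notMem _ _ _ hi, Finset.piecewise_eq_of_notMem _ _ _ hi,
        Finset.piecewise_eq_of_notMem _ _ _ hi]
  rw [h2] at this
  rw [this, Finset.prod_const, smul_eq_mul, mul_comm]
  simp only [eval_mul, eval_C, eval_pow, eval_X]

lemma linePoly_natDegree_le {m : ℕ} (M : MultilinearMap ℂ (fun _ : Fin m => V) ℂ) (v a : V) :
    (linePoly M v a).natDegree ≤ m := by
  refine natDegree_sum_le_of_forall_le _ _ fun s _ => ?_
  refine (natDegree_C_mul_X_pow_le _ _).trans ?_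
  simpa using Finset.card_le_univ s

lemma linePoly_coeff_top {m : ℕ} (M : MultilinearMap ℂ (fun _ : Fin m => V) ℂ) (v a : V) :
    (linePoly M v a).coeff m = M (fun _ => a) := by
  rw [linePoly, finsetSum_coeff, Finset.sum_eq_single Finset.univ]
  · simp
  · intro s _ hs
    rw [coeff_C_mul_X_pow, if_neg]
    intro h
    exact hs ((Finset.card_eq_iff_eq_univ s).1 (by simpa using h.symm))
  · simp

lemma linePoly_natDegree {m : ℕ} (M : MultilinearMap ℂ (fun _ : Fin m => V) ℂ) (v a : V)
    (h : M (fun _ => a) ≠ 0) : (linePoly M v a).natDegree = m :=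
  natDegree_eq_of_le_of_coeff_ne_zero (linePoly_natDegree_le M v a)
    (by rwa [linePoly_coeff_top])

lemma linePoly_coeff_one {m : ℕ} (M : MultilinearMap ℂ (fun _ : Fin (m+1) => V) ℂ)
    (hsym : ∀ (σ : Equiv.Perm (Fin (m+1))) v, M (fun i => v (σ i)) = M v) (v a : V) :
    (linePoly M v a).coeff 1 = (m+1 : ℂ) * M (Fin.cons a (fun _ => v)) := by
  classical
  rw [linePoly, finsetSum_coeff]
  simp_rw [coeff_C_mul_X_pow]
  rw [← Finset.sum_filter]
  have h1 : (Finset.univ.filter fun s : Finset (Fin (m+1)) => 1 = s.card)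
      = Finset.univ.image (fun i : Fin (m+1) => ({i} : Finset (Fin (m+1)))) := by
    ext s
    simp only [Finset.mem_filter, Finset.mem_univ, true_and, Finset.mem_image]
    rw [eq_comm, Finset.card_eq_one]
    constructor
    · rintro ⟨i, rfl⟩; exact ⟨i, rfl⟩
    · rintro ⟨i, rfl⟩; exact ⟨i, rfl⟩
  rw [h1, Finset.sum_image (fun i _ j _ h => Finset.singleton_injective h)]
  have h2 : ∀ i : Fin (m+1), M (({i} : Finset (Fin (m+1))).piecewise (fun _ => a) (fun _ => v))
      = M (Fin.cons a (fun _ => v)) := by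
    intro i
    rw [← hsym (Equiv.swap 0 i) (Fin.cons a (fun _ => v))]
    congr 1
    funext j
    by_cases hj : j = i
    · subst hj; simp
    · have h3 : Equiv.swap 0 i j ≠ 0 := by
        intro h
        apply hj
        have := congrArg (Equiv.swap 0 i) h
        simpa using this
      obtain ⟨k, hk⟩ := Fin.exists_succ_eq.2 h3
      rw [← hk]; simp [hj]
  rw [Finset.sum_congr rfl fun i _ => h2 i]
  simp

lemma linePoly_derivative_zero {m : ℕ} (M : MultilinearMap ℂ (fun _ : Fin (m+1) => V) ℂ)
    (hsym : ∀ (σ : Equiv.Perm (Fin (m+1))) v, M (fun i => v (σ i)) = M v) (v a : V) :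
    (linePoly M v a).derivative.eval 0 = (m+1 : ℂ) * M (Fin.cons a (fun _ => v)) := by
  rw [← linePoly_coeff_one M hsym, ← coeff_zero_eq_eval_zero, coeff_derivative]
  simp

lemma const_smul_eval {m : ℕ} (M : MultilinearMap ℂ (fun _ : Fin m => V) ℂ) (c : ℂ) (v : V) :
    M (fun _ => c • v) = c ^ m * M (fun _ => v) := by
  have := M.map_smul_univ (fun _ => c) (fun _ => v)
  simpa using this

variable {W : Type*} [AddCommGroup W] [Module ℝ W] [Module ℝ V] [IsScalarTower ℝ ℂ V]

/-- Stability in both half-planes. -/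
lemma stable_of_im_ne_zero (ι : W →ₗ[ℝ] V) (C : Set W) (hsmul : ∀ c : ℝ, 0 < c → ∀ x ∈ C, c • x ∈ C)
    {m : ℕ} (M : MultilinearMap ℂ (fun _ : Fin m => V) ℂ)
    (hst : ∀ y, ∀ x ∈ C, M (fun _ => ι y + Complex.I • ι x) ≠ 0)
    (y x : W) (hx : x ∈ C) (t : ℂ) (ht : t.im ≠ 0) : M (fun _ => ι y + t • ι x) ≠ 0 := by
  have hreal : ∀ (r : ℝ) (v : V), ((r : ℂ)) • v = r • v := fun r v => by
    rw [← Complex.coe_algebraMap, algebraMap_smul]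
  have hdec : ∀ t : ℂ, ι y + t • ι x = ι (y + t.re • x) + Complex.I • ι (t.im • x) := by
    intro t
    rw [map_add, map_smul, map_smul, ← hreal, ← hreal, smul_smul, add_assoc, ← add_smul]
    congr 2
    conv_lhs => rw [← Complex.re_add_im t]
    ring
  rcases lt_or_gt_of_ne ht with h | h
  · have h1 : ι y + t • ι x = (-1 : ℂ) • (ι (-(y + t.re • x)) + Complex.I • ι ((-t.im) • x)) := by
      rw [hdec t, map_neg, neg_smul t.im, map_neg]
      module
    rw [h1, const_smul_eval]
    exact mul_ne_zero (by simp) (hst _ _ (hsmul _ (by linarith) x hx))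
  · rw [hdec t]
    exact hst _ _ (hsmul _ h x hx)

lemma step_inequality (ι : W →ₗ[ℝ] V) (C : Set W) (hadd : ∀ x ∈ C, ∀ y ∈ C, x + y ∈ C)
    (hsmul : ∀ c : ℝ, 0 < c → ∀ x ∈ C, c • x ∈ C)
    {m : ℕ} (M : MultilinearMap ℂ (fun _ : Fin (m+1) => V) ℂ)
    (hsym : ∀ (σ : Equiv.Perm (Fin (m+1))) v, M (fun i => v (σ i)) = M v)
    (hpos : ∀ a ∈ C, ∃ r : ℝ, 0 < r ∧ M (fun _ => ι a) = r)
    (hst : ∀ y, ∀ x ∈ C, M (fun _ => ι y + Complex.I • ι x) ≠ 0)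
    (a : W) (ha : a ∈ C) (x : W) (hx : x ∈ C) :
    ∃ r : ℝ, 0 < r ∧ M (Fin.cons (ι a) (fun _ => ι x)) = r ∧
      ‖M (fun _ => ι a)‖ * ‖M (fun _ => ι x)‖ ^ m ≤ r ^ (m+1) := by
  have hreal : ∀ (r : ℝ) (v : V), ((r : ℂ)) • v = r • v := fun r v => by
    rw [← Complex.coe_algebraMap, algebraMap_smul]
  obtain ⟨pa, hpa, hpa'⟩ := hpos a ha
  obtain ⟨px, hpx, hpx'⟩ := hpos x hx
  set Q := linePoly M (ι x) (ι a) with hQ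
  have hdeg : Q.natDegree = m+1 := linePoly_natDegree M _ _ (by
    rw [hpa']; exact_mod_cast hpa.ne')
  have hlead : Q.leadingCoeff = pa := by
    rw [leadingCoeff, hdeg, hQ, linePoly_coeff_top, hpa']
  have hQ0 : Q ≠ 0 := by intro h; rw [h] at hdeg; simp at hdeg
  have hev0 : Q.eval 0 = px := by rw [hQ, linePoly_eval, ← hpx']; simp
  have hev0' : Q.eval 0 ≠ 0 := by rw [hev0]; exact_mod_cast hpx.ne'
  have hs : Q.Splits := IsAlgClosed.splits Q
  have hroot : ∀ r ∈ Q.roots, r = ((r.re : ℝ) : ℂ) ∧ r.re < 0 := by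
    intro r hr
    have hr0 : Q.eval r = 0 := (mem_roots hQ0).1 hr
    rw [hQ, linePoly_eval] at hr0
    have him : r.im = 0 := by
      by_contra him
      exact stable_of_im_ne_zero ι C hsmul M hst x a ha r him hr0
    have hre : r = ((r.re : ℝ) : ℂ) := by apply Complex.ext <;> simp [him]
    refine ⟨hre, ?_⟩
    by_contra hneg
    push Not at hneg
    have hmem : x + r.re • a ∈ C := by
      rcases hneg.eq_or_lt with h | h
      · rw [← h]; simpa using hx
      · exact hadd _ hx _ (hsmul _ h _ ha)
    obtain ⟨q, hq, hq'⟩ := hpos _ hmem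
    rw [map_add, map_smul, ← hreal, ← hre, hr0] at hq'
    exact hq.ne' (by exact_mod_cast hq'.symm)
  set s : Multiset ℝ := Q.roots.map (fun r => (-r.re)⁻¹) with hsdef
  have hspos : ∀ z ∈ s, 0 < z := by
    intro z hz
    rw [hsdef, Multiset.mem_map] at hz
    obtain ⟨r, hr, rfl⟩ := hz
    have := (hroot r hr).2
    exact inv_pos.2 (by linarith)
  have hcard : Multiset.card s = m+1 := by
    rw [hsdef, Multiset.card_map, ← hs.natDegree_eq_card_roots, hdeg]
  have hsumpos : 0 < s.sum := by
    have : s ≠ 0 := by rintro h; rw [h] at hcard; simp at hcard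
    obtain ⟨z, hz⟩ := Multiset.exists_mem_of_ne_zero this
    obtain ⟨s', hs'⟩ := Multiset.exists_cons_of_mem hz
    rw [hs', Multiset.sum_cons]
    have h1 := hspos z hz
    have h2 : 0 ≤ s'.sum := Multiset.sum_nonneg fun w hw => (hspos w (by rw [hs']; simp [hw])).le
    linarith
  have hsum : ((s.sum : ℝ) : ℂ) = (Q.roots.map fun z => 1 / (0 - z)).sum := by
    have : ((s.sum : ℝ) : ℂ) = (s.map (fun z : ℝ => (z : ℂ))).sum :=
      map_multiset_sum (Complex.ofRealHom) s
    rw [this, hsdef, Multiset.map_map]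
    congr 1
    refine Multiset.map_congr rfl fun r hr => ?_
    rw [(hroot r hr).1]; simp
  have hprod : px * s.prod = pa := by
    have h1 : ((px : ℝ) : ℂ) = pa * (Q.roots.map fun z => 0 - z).prod := by
      rw [← hev0, hs.eval_eq_prod_roots, hlead]
    have h2 : (Q.roots.map fun z => 0 - z).prod = (((s.prod)⁻¹ : ℝ) : ℂ) := by
      have h3 : (s.prod)⁻¹ = (Q.roots.map fun r => -r.re).prod := by
        rw [hsdef, Multiset.prod_map_inv, inv_inv]
      have h4 : (((Q.roots.map fun r => -r.re).prod : ℝ) : ℂ)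
          = ((Q.roots.map fun r => -r.re).map (fun z : ℝ => (z : ℂ))).prod :=
        map_multiset_prod (Complex.ofRealHom) _
      rw [h3, h4, Multiset.map_map]
      congr 1
      refine Multiset.map_congr rfl fun r hr => ?_
      rw [(hroot r hr).1]; simp
    rw [h2] at h1
    have h5 : px = pa * (s.prod)⁻¹ := by exact_mod_cast h1
    have h6 : s.prod ≠ 0 := by
      intro h
      rw [Multiset.prod_eq_zero_iff] at h
      exact lt_irrefl _ (hspos 0 h)
    rw [h5]; field_simp
  have hder := linePoly_derivative_zero M hsym (ι x) (ι a)
  rw [← hQ, hs.eval_derivative_eq_eval_mul_sum hev0', hev0, ← hsum] at hder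
  refine ⟨px * s.sum / (m+1), by positivity, ?_, ?_⟩
  · have : ((m:ℂ)+1) ≠ 0 := by exact_mod_cast (Nat.succ_ne_zero m)
    push_cast
    rw [hder]; field_simp
  · rw [hpa', hpx', Complex.norm_real, Complex.norm_real, Real.norm_of_nonneg hpa.le,
      Real.norm_of_nonneg hpx.le]
    have hag := multiset_amgm s hspos
    rw [hcard] at hag
    have hm : (0:ℝ) < (m:ℝ)+1 := by positivity
    rw [div_pow, mul_pow, le_div_iff₀ (by positivity), ← hprod]
    calc px * s.prod * px ^ m * ((m:ℝ)+1)^(m+1)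
        = px^(m+1) * (s.prod * (((m+1 : ℕ) : ℝ))^(m+1)) := by push_cast; ring
      _ ≤ _ := by gcongr

lemma step_stable (ι : W →ₗ[ℝ] V) (C : Set W) (hadd : ∀ x ∈ C, ∀ y ∈ C, x + y ∈ C)
    (hsmul : ∀ c : ℝ, 0 < c → ∀ x ∈ C, c • x ∈ C)
    {m : ℕ} (M : MultilinearMap ℂ (fun _ : Fin (m+1) => V) ℂ)
    (hsym : ∀ (σ : Equiv.Perm (Fin (m+1))) v, M (fun i => v (σ i)) = M v)
    (hpos : ∀ a ∈ C, ∃ r : ℝ, 0 < r ∧ M (fun _ => ι a) = r)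
    (hst : ∀ y, ∀ x ∈ C, M (fun _ => ι y + Complex.I • ι x) ≠ 0)
    (a : W) (ha : a ∈ C) (y x : W) (hx : x ∈ C) :
    M (Fin.cons (ι a) (fun _ => ι y + Complex.I • ι x)) ≠ 0 := by
  have hreal : ∀ (r : ℝ) (v : V), ((r : ℂ)) • v = r • v := fun r v => by
    rw [← Complex.coe_algebraMap, algebraMap_smul]
  obtain ⟨pa, hpa, hpa'⟩ := hpos a ha
  set Q := linePoly M (ι y + Complex.I • ι x) (ι a) with hQ
  have hdeg : Q.natDegree = m+1 := linePoly_natDegree M _ _ (by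
    rw [hpa']; exact_mod_cast hpa.ne')
  have h1 : Q.derivative.eval 0 ≠ 0 := by
    apply derivative_eval_ne_zero_of_roots_below Q (by omega)
    intro r hr
    rw [hQ, linePoly_eval] at hr
    by_contra hneg
    simp only [Complex.zero_im, not_lt] at hneg
    have hmem : x + r.im • a ∈ C := by
      rcases hneg.eq_or_lt with h | h
      · rw [← h]; simpa using hx
      · exact hadd _ hx _ (hsmul _ h _ ha)
    refine hst (y + r.re • a) _ hmem ?_
    rw [← hr]
    congr 1
    funext _
    conv_rhs => rw [← Complex.re_add_im r]
    rw [map_add, map_add, map_smul, map_smul, ← hreal, ← hreal]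
    module
  rw [hQ, linePoly_derivative_zero M hsym] at h1
  exact right_ne_zero_of_mul h1

theorem garding_main (ι : W →ₗ[ℝ] V) (C : Set W) (hadd : ∀ x ∈ C, ∀ y ∈ C, x + y ∈ C)
    (hsmul : ∀ c : ℝ, 0 < c → ∀ x ∈ C, c • x ∈ C) :
    ∀ (m : ℕ) (M : MultilinearMap ℂ (fun _ : Fin m => V) ℂ)
    (_ : ∀ (σ : Equiv.Perm (Fin m)) v, M (fun i => v (σ i)) = M v)
    (_ : ∀ a ∈ C, ∃ r : ℝ, 0 < r ∧ M (fun _ => ι a) = r)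
    (_ : ∀ y, ∀ x ∈ C, M (fun _ => ι y + Complex.I • ι x) ≠ 0)
    (x : Fin m → W) (_ : ∀ j, x j ∈ C),
    (m ≠ 0 → ∃ r : ℝ, 0 < r ∧ M (fun j => ι (x j)) = r) ∧
      ∏ j, ‖M (fun _ => ι (x j))‖ ≤ ‖M (fun j => ι (x j))‖ ^ m := by
  intro m
  induction m with
  | zero =>
    intro M hsym hpos hst x hx
    exact ⟨fun h => absurd rfl h, by simp⟩
  | succ m ih =>
    intro M hsym hpos hst x hx
    have ih' := ih (M.curryLeft (ι (x 0))) ?_ ?_ ?_ (fun j => x j.succ) (fun j => hx _)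
    · simp only [MultilinearMap.curryLeft_apply] at ih'
      have hcons : (Fin.cons (ι (x 0)) (fun j : Fin m => ι (x j.succ)) : Fin (m+1) → V)
          = fun j => ι (x j) := by
        funext j; refine Fin.cases ?_ (fun j => ?_) j <;> simp
      rw [hcons] at ih'
      obtain ⟨hr, hle⟩ := ih'
      rcases Nat.eq_zero_or_pos m with h0 | hmpos
      · subst h0
        have hx0 : (fun j => ι (x j)) = fun _ : Fin 1 => ι (x 0) := by
          funext j; rw [show j = 0 from Fin.fin_one_eq_zero j]
        obtain ⟨r', h1, h2⟩ := hpos (x 0) (hx 0)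
        refine ⟨fun _ => ⟨r', h1, by rw [← h2]; exact congrArg M hx0⟩, ?_⟩
        rw [hx0]; simp
      · refine ⟨fun _ => hr hmpos.ne', ?_⟩
        have hpow : (∏ j, ‖M (fun _ => ι (x j))‖) ^ m ≤ (‖M (fun j => ι (x j))‖ ^ (m+1)) ^ m := by
          calc (∏ j, ‖M (fun _ => ι (x j))‖) ^ m
              = ∏ j : Fin m, (‖M (fun _ => ι (x 0))‖ * ‖M (fun _ => ι (x j.succ))‖ ^ m) := by
                rw [Fin.prod_univ_succ, mul_pow, Finset.prod_mul_distrib, Finset.prod_pow]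
                simp
            _ ≤ ∏ j : Fin m, ‖M (Fin.cons (ι (x 0)) (fun _ => ι (x j.succ)))‖ ^ (m+1) := by
                refine Finset.prod_le_prod (fun _ _ => by positivity) fun j _ => ?_
                obtain ⟨q, hq, hq', hq''⟩ := step_inequality ι C hadd hsmul M hsym hpos hst
                  (x 0) (hx 0) (x j.succ) (hx _)
                rw [hq', Complex.norm_real, Real.norm_of_nonneg hq.le]
                exact hq''
            _ = (∏ j : Fin m, ‖M (Fin.cons (ι (x 0)) (fun _ => ι (x j.succ)))‖) ^ (m+1) := by
                rw [Finset.prod_pow]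
            _ ≤ (‖M (fun j => ι (x j))‖ ^ m) ^ (m+1) :=
                pow_le_pow_left₀ (Finset.prod_nonneg fun _ _ => norm_nonneg _) hle _
            _ = _ := by rw [← pow_mul, ← pow_mul, mul_comm]
        exact le_of_pow_le_pow_left₀ hmpos.ne' (by positivity) hpow
    · intro σ v
      simp only [MultilinearMap.curryLeft_apply]
      rw [← hsym (Equiv.Perm.decomposeFin.symm (0, σ)) (Fin.cons _ v)]
      congr 1
      funext j
      refine Fin.cases ?_ (fun j => ?_) j <;> simp
    · intro a ha
      obtain ⟨q, hq, hq', _⟩ := step_inequality ι C hadd hsmul M hsym hpos hst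
                  (x 0) (hx 0) a ha
      exact ⟨q, hq, hq'⟩
    · intro y z hz
      exact step_stable ι C hadd hsmul M hsym hpos hst (x 0) (hx 0) y z hz
end line

section homotopy
open Polynomial
variable {V : Type*} [NormedAddCommGroup V] [NormedSpace ℂ V]

lemma homotopy_stable {m : ℕ} (M : MultilinearMap ℂ (fun _ : Fin m => V) ℂ)
    (hcont : Continuous fun v => M (fun _ => v)) (x u w : V) (hx : M (fun _ => x) ≠ 0)
    (hre : ∀ γ : ℝ, 0 ≤ γ → γ ≤ 1 → ∀ s : ℝ,
      M (fun _ => u + (γ:ℂ) • w + (s : ℂ) • x) ≠ 0)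
    (h0 : ∀ s : ℂ, 0 ≤ s.im → M (fun _ => u + s • x) ≠ 0) :
    ∀ s : ℂ, 0 ≤ s.im → M (fun _ => u + w + s • x) ≠ 0 := by
  let F : unitInterval × ℂ → ℂ := fun q => M (fun _ => u + ((q.1 : ℝ) : ℂ) • w + q.2 • x)
  have hF : Continuous F := by
    have : Continuous fun q : unitInterval × ℂ => u + ((q.1 : ℝ) : ℂ) • w + q.2 • x := by
      fun_prop
    exact hcont.comp this
  let G : Set unitInterval := {γ | ∀ s : ℂ, 0 ≤ s.im → F (γ, s) ≠ 0}
  obtain ⟨δ, hδ, hδ'⟩ : ∃ δ > 0, ∀ v, ‖v‖ < δ → M (fun _ => x + v) ≠ 0 := by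
    have h1 : Continuous fun v => M (fun _ => x + v) :=
      hcont.comp (continuous_const.add continuous_id)
    have h2 : ∀ᶠ v in nhds (0:V), M (fun _ => x + v) ≠ 0 :=
      h1.continuousAt.eventually_ne (by simpa using hx)
    obtain ⟨δ, hδ, h3⟩ := Metric.eventually_nhds_iff.1 h2
    exact ⟨δ, hδ, fun v hv => h3 (by simpa using hv)⟩
  set B : ℝ := (‖u‖ + ‖w‖) / δ with hB
  have hBnn : 0 ≤ B := by positivity
  have hbound : ∀ γ s, F (γ, s) = 0 → ‖s‖ ≤ B := by
    intro γ s hs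
    by_contra hlt
    push Not at hlt
    have hspos : 0 < ‖s‖ := lt_of_le_of_lt hBnn hlt
    have hs0 : s ≠ 0 := norm_pos_iff.1 hspos
    have h1 : u + ((γ : ℝ) : ℂ) • w + s • x = s • (x + s⁻¹ • (u + ((γ : ℝ) : ℂ) • w)) := by
      rw [smul_add, smul_inv_smul₀ hs0, add_comm]
    have h2 : F (γ, s) = s ^ m * M (fun _ => x + s⁻¹ • (u + ((γ : ℝ) : ℂ) • w)) := by
      show M _ = _
      rw [h1]
      have := M.map_smul_univ (fun _ => s) (fun _ => x + s⁻¹ • (u + ((γ : ℝ) : ℂ) • w))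
      simpa using this
    rw [h2] at hs
    refine mul_ne_zero (pow_ne_zero _ hs0) (hδ' _ ?_) hs
    have hγ : ‖((γ : ℝ) : ℂ)‖ ≤ 1 := by
      rw [Complex.norm_real, Real.norm_of_nonneg γ.2.1]; exact γ.2.2
    rw [norm_smul, norm_inv]
    have h3 : ‖u + ((γ : ℝ) : ℂ) • w‖ ≤ ‖u‖ + ‖w‖ := by
      refine (norm_add_le _ _).trans ?_
      rw [norm_smul]
      have := mul_le_mul_of_nonneg_right hγ (norm_nonneg w)
      linarith
    rw [inv_mul_lt_iff₀ hspos]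
    rw [hB, div_lt_iff₀ hδ] at hlt
    linarith
  have hopen : IsOpen G := by
    rw [← isClosed_compl_iff]
    let Z : Set (unitInterval × ℂ) :=
      (Set.univ ×ˢ Metric.closedBall (0:ℂ) B) ∩ {q | 0 ≤ q.2.im ∧ F q = 0}
    have hZ : IsCompact Z := by
      refine (isCompact_univ.prod (isCompact_closedBall _ _)).inter_right ?_
      refine IsClosed.inter ?_ ?_
      · exact isClosed_le continuous_const (Complex.continuous_im.comp continuous_snd)
      · exact isClosed_eq hF continuous_const
    have : Gᶜ = Prod.fst '' Z := by
      ext γ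
      constructor
      · intro h
        simp only [G, Set.mem_compl_iff, Set.mem_ofPred_eq, not_forall, not_not] at h
        obtain ⟨s, hs, hs'⟩ := h
        exact ⟨(γ, s), ⟨⟨trivial, by simpa using hbound _ _ hs'⟩, hs, hs'⟩, rfl⟩
      · rintro ⟨⟨γ', s⟩, ⟨_, hs, hs'⟩, rfl⟩ hG
        exact hG s hs hs'
    rw [this]
    exact (hZ.image continuous_fst).isClosed
  have hclosed : IsClosed G := by
    refine isClosed_of_closure_subset fun γ hγ s hs hs' => ?_
    have hspos : 0 < s.im := by
      refine lt_of_le_of_ne hs fun h => ?_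
      refine hre γ γ.2.1 γ.2.2 s.re ?_
      have : ((s.re : ℝ) : ℂ) = s := by apply Complex.ext <;> simp [← h]
      rw [this]; exact hs'
    have hsub : G ⊆ {γ' | ‖M (fun _ => x)‖ * s.im ^ m ≤ ‖F (γ', s)‖} := by
      intro γ' hγ'
      set Q := linePoly M (u + ((γ' : ℝ) : ℂ) • w) x with hQ
      have hdeg : Q.natDegree = m := linePoly_natDegree M _ _ hx
      have hlead : Q.leadingCoeff = M (fun _ => x) := by
        rw [leadingCoeff, hdeg, hQ, linePoly_coeff_top]
      have hQ0 : Q ≠ 0 := by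
        intro h; rw [h] at hlead; exact hx (by simpa using hlead.symm)
      have hsp : Q.Splits := IsAlgClosed.splits Q
      have hev : F (γ', s) = Q.eval s := by rw [hQ, linePoly_eval]
      show _ ≤ ‖F (γ', s)‖
      rw [hev, hsp.eval_eq_prod_roots, hlead, norm_mul]
      refine mul_le_mul_of_nonneg_left ?_ (norm_nonneg _)
      have hcard : Multiset.card Q.roots = m := by rw [← hsp.natDegree_eq_card_roots, hdeg]
      have hroots : ∀ r ∈ Q.roots, r.im < 0 := by
        intro r hr
        have hr0 : Q.eval r = 0 := (mem_roots hQ0).1 hr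
        rw [hQ, linePoly_eval] at hr0
        by_contra hneg
        exact hγ' r (not_lt.1 hneg) hr0
      have key : ∀ T : Multiset ℂ, (∀ r ∈ T, r.im < 0) →
          s.im ^ (Multiset.card T) ≤ ‖(T.map fun r => s - r).prod‖ := by
        intro T
        induction T using Multiset.induction_on with
        | empty => simp
        | cons a T ih =>
          intro hT
          rw [Multiset.map_cons, Multiset.prod_cons, norm_mul, Multiset.card_cons, pow_succ,
            mul_comm]
          have h1 := ih fun r hr => hT r (by simp [hr])
          have h2 : s.im ≤ ‖s - a‖ := by
            have h3 := hT a (by simp)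
            have h4 := Complex.abs_im_le_norm (s - a)
            rw [Complex.sub_im] at h4
            have := le_abs_self (s.im - a.im)
            linarith
          exact mul_le_mul h2 h1 (by positivity) (norm_nonneg _)
      have := key Q.roots hroots
      rwa [hcard] at this
    have hcl : IsClosed {γ' | ‖M (fun _ => x)‖ * s.im ^ m ≤ ‖F (γ', s)‖} := by
      refine isClosed_le continuous_const ?_
      exact (hF.comp (continuous_id.prodMk continuous_const)).norm
    have := closure_minimal hsub hcl hγ
    simp only [Set.mem_ofPred_eq] at this
    rw [hs', norm_zero] at this
    have h5 : 0 < ‖M (fun _ => x)‖ := norm_pos_iff.2 hx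
    have : 0 < ‖M (fun _ => x)‖ * s.im ^ m := by positivity
    linarith
  have huniv : G = Set.univ := by
    refine IsClopen.eq_univ ⟨hclosed, hopen⟩ ⟨0, fun s hs => ?_⟩
    have := h0 s hs
    simpa [F] using this
  intro s hs
  have h1 : (1 : unitInterval) ∈ G := by rw [huniv]; trivial
  have := h1 s hs
  simpa [F] using this

variable {W : Type*} [AddCommGroup W] [Module ℝ W] [Module ℝ V] [IsScalarTower ℝ ℂ V]

lemma cone_stable {J : Type*} [DecidableEq J] (ι : W →ₗ[ℝ] V) {m : ℕ}
    (M : MultilinearMap ℂ (fun _ : Fin m => V) ℂ)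
    (hcont : Continuous fun v => M (fun _ => v)) (e : W) (z : J → W)
    (he : ∀ y, ∀ α : ℝ, 0 < α → M (fun _ => ι y + Complex.I • ι (α • e)) ≠ 0)
    (hz : ∀ j, ∀ t : ℝ, 0 ≤ t → M (fun _ => ι (z j + t • e)) ≠ 0) (S : Finset J) :
    ∀ y, ∀ α : ℝ, 0 < α → ∀ σ : J → ℝ, (∀ j, 0 ≤ σ j) →
      M (fun _ => ι y + Complex.I • ι (α • e + ∑ j ∈ S, σ j • z j)) ≠ 0 := by
  have hreal : ∀ (r : ℝ) (v : V), ((r : ℂ)) • v = r • v := fun r v => by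
    rw [← Complex.coe_algebraMap, algebraMap_smul]
  induction S using Finset.induction_on with
  | empty => intro y α hα σ _; simpa using he y α hα
  | insert k S hk ih =>
    intro y α hα σ hσ
    have hmain := homotopy_stable M hcont (ι (z k)) (Complex.I • ι (α • e))
      (ι y + Complex.I • ι (∑ j ∈ S, σ j • z j)) (by simpa using hz k 0 le_rfl) ?_ ?_
      (Complex.I * σ k) (by simpa using hσ k)
    · rw [Finset.sum_insert hk]
      convert hmain using 3
      rw [map_add, map_add, map_smul ι (σ k), ← hreal]
      module
    · intro γ hγ _ s
      have := ih (γ • y + s • z k) α hα (fun j => γ * σ j) (fun j => mul_nonneg hγ (hσ j))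
      convert this using 3
      simp only [mul_smul, ← Finset.smul_sum]
      rw [map_add, map_add, map_smul ι γ, map_smul ι s, map_smul ι γ, ← hreal, ← hreal, ← hreal]
      module
    · intro s hs
      by_cases hs0 : s = 0
      · subst hs0; simpa using he 0 α hα
      have h1 : Complex.I • ι (α • e) + s • ι (z k)
          = s • (ι (z k) + (Complex.I * α / s) • ι e) := by
        rw [smul_add, smul_smul, mul_div_cancel₀ _ hs0, map_smul, ← hreal, smul_smul, add_comm]
      rw [h1, const_smul_eval]
      refine mul_ne_zero (pow_ne_zero _ hs0) ?_
      by_cases him : (Complex.I * α / s).im = 0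
      · set t := Complex.I * α / s with ht
        have htre : ((t.re : ℝ) : ℂ) = t := by apply Complex.ext <;> simp [him]
        rw [← htre, hreal, ← map_smul, ← map_add]
        apply hz
        rw [ht, Complex.div_re]
        simp
        exact div_nonneg (mul_nonneg hα.le hs) (Complex.normSq_nonneg _)
      · refine stable_of_im_ne_zero ι {w | ∃ α : ℝ, 0 < α ∧ w = α • e} ?_ M ?_ (z k) e
          ⟨1, one_pos, by simp⟩ _ him
        · rintro c hc _ ⟨a, ha, rfl⟩
          exact ⟨c * a, mul_pos hc ha, by rw [mul_smul]⟩
        · rintro y _ ⟨a, ha, rfl⟩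
          exact he y a ha
end homotopy

section concrete
open Polynomial

/-- Elementary symmetric function over a general commutative ring. -/
noncomputable def gsymm {R : Type*} [CommRing R] {n : ℕ} (x : Fin n → R) (k : ℕ) : R :=
  ∑ S ∈ Finset.powersetCard k (Finset.univ : Finset (Fin n)), ∏ i ∈ S, x i

lemma gsymm_shift {R : Type*} [CommRing R] {n m : ℕ} (hmn : m ≤ n) (x : Fin n → R) (t : R) :
    gsymm (fun i => x i + t) m
      = (hasseDeriv (n - m) (∏ i, (X + C (x i)))).eval t := by
  rw [← taylor_coeff]
  have h1 : taylor t (∏ i, (X + C (x i))) = ∏ i, (X + C (x i + t)) := by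
    rw [taylor_apply, prod_comp]
    refine Finset.prod_congr rfl fun i _ => ?_
    simp; ring
  rw [h1, Finset.prod_X_add_C_coeff _ _ (by simp)]
  simp only [Finset.card_univ, Fintype.card_fin]
  rw [show n - (n - m) = m by omega]
  rfl

lemma gsymm_pos_shift {n m : ℕ} (hmn : m ≤ n) (x : Fin n → ℝ)
    (hx : ∀ k, 1 ≤ k → k ≤ m → 0 ≤ gsymm x k) (t : ℝ) (ht : 0 < t) :
    0 < gsymm (fun i => x i + t) m := by
  rw [gsymm_shift hmn]
  set G : ℝ[X] := ∏ i, (X + C (x i)) with hG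
  have hdeg : G.natDegree = n := by
    rw [hG, natDegree_prod_of_monic _ _ fun i _ => monic_X_add_C _]; simp
  have hcoeff : ∀ j, j ≤ m → (hasseDeriv (n - m) G).coeff j
      = ((j + (n - m)).choose (n - m) : ℝ) * gsymm x (m - j) := by
    intro j hj
    rw [hasseDeriv_coeff, hG, Finset.prod_X_add_C_coeff _ _ (by simp; omega)]
    simp only [Finset.card_univ, Fintype.card_fin]
    rw [show n - (j + (n - m)) = m - j by omega]
    rfl
  have hdeg' : (hasseDeriv (n - m) G).natDegree < m + 1 := by
    have := natDegree_hasseDeriv_le G (n - m)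
    omega
  rw [eval_eq_sum_range' hdeg']
  refine Finset.sum_pos' (fun j hj => ?_) ⟨m, by simp, ?_⟩
  · have hj' : j ≤ m := by simp at hj; omega
    rw [hcoeff j hj']
    rcases hj'.eq_or_lt with h | h
    · subst h
      have : gsymm x (j - j) = 1 := by simp [gsymm]
      rw [this]; positivity
    · have := hx (m - j) (by omega) (by omega)
      positivity
  · rw [hcoeff m le_rfl]
    have : gsymm x (m - m) = 1 := by simp [gsymm]
    rw [this]
    have : 0 < (m + (n - m)).choose (n - m) := Nat.choose_pos (by omega)
    positivity

lemma iterate_derivative_roots : ∀ (k : ℕ) (P : ℂ[X]), (∀ z : ℂ, 0 < z.im → P.eval z ≠ 0) →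
    k ≤ P.natDegree → ∀ z : ℂ, 0 < z.im → (derivative^[k] P).eval z ≠ 0 := by
  intro k
  induction k with
  | zero => intro P h _; simpa using h
  | succ k ih =>
    intro P h hk z hz
    rw [Function.iterate_succ_apply]
    refine ih _ (fun w hw => ?_) ?_ z hz
    · apply derivative_eval_ne_zero_of_roots_below P (by omega)
      intro r hr
      by_contra hneg
      exact h r (by linarith) hr
    · obtain ⟨d, hd⟩ : ∃ d, P.natDegree = d + 1 := ⟨P.natDegree - 1, by omega⟩
      have h1 : P.derivative.coeff d ≠ 0 := by
        rw [coeff_derivative, ← hd]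
        refine mul_ne_zero ?_ (by exact_mod_cast Nat.succ_ne_zero d)
        rw [coeff_natDegree, leadingCoeff_ne_zero]
        rintro rfl
        simp at hd
      have := le_natDegree_of_ne_zero h1
      omega

lemma gsymm_hyperbolic {n m : ℕ} (hmn : m ≤ n) (y : Fin n → ℝ) (z : ℂ) (hz : 0 < z.im) :
    gsymm (fun i => (y i : ℂ) + z) m ≠ 0 := by
  rw [gsymm_shift hmn]
  set G : ℂ[X] := ∏ i, (X + C ((y i : ℝ) : ℂ)) with hG
  have hdeg : G.natDegree = n := by
    rw [hG, natDegree_prod_of_monic _ _ fun i _ => monic_X_add_C _]; simp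
  have h1 : ∀ z : ℂ, 0 < z.im → G.eval z ≠ 0 := by
    intro z hz h
    rw [hG, eval_prod, Finset.prod_eq_zero_iff] at h
    obtain ⟨i, _, hi⟩ := h
    have := congrArg Complex.im hi
    simp at this
    linarith
  have h2 := iterate_derivative_roots (n - m) G h1 (by omega) z hz
  rw [← factorial_smul_hasseDeriv] at h2
  intro h3
  apply h2
  simp [h3]

/-- Unnormalised polarization of `e_m`. -/
noncomputable def symForm (n m : ℕ) : MultilinearMap ℂ (fun _ : Fin m => (Fin n → ℂ)) ℂ :=
  ∑ f : Fin m ↪ Fin n, (MultilinearMap.mkPiAlgebra ℂ (Fin m) ℂ).compLinearMap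
    (fun k => LinearMap.proj (f k))

lemma symForm_apply {n m : ℕ} (v : Fin m → Fin n → ℂ) :
    symForm n m v = ∑ f : Fin m ↪ Fin n, ∏ k, v k (f k) := by
  simp [symForm]

lemma symForm_symm {n m : ℕ} (σ : Equiv.Perm (Fin m)) (v : Fin m → Fin n → ℂ) :
    symForm n m (fun i => v (σ i)) = symForm n m v := by
  rw [symForm_apply, symForm_apply]
  refine Fintype.sum_equiv (Equiv.embeddingCongr σ (Equiv.refl _)) _ _ fun f => ?_
  refine Fintype.prod_equiv σ _ _ fun k => ?_
  simp

lemma symForm_diag {n m : ℕ} (v : Fin n → ℂ) :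
    symForm n m (fun _ => v) = m.factorial * gsymm v m := by
  classical
  rw [symForm_apply, gsymm, Finset.mul_sum]
  rw [← Finset.sum_fiberwise_of_maps_to (s := Finset.univ)
    (t := Finset.powersetCard m (Finset.univ : Finset (Fin n)))
    (g := fun f : Fin m ↪ Fin n => Finset.univ.map f) (by intro f _; simp [Finset.mem_powersetCard])]
  refine Finset.sum_congr rfl fun S hS => ?_
  rw [Finset.mem_powersetCard] at hS
  have h1 : ∀ f ∈ (Finset.univ.filter fun f : Fin m ↪ Fin n => Finset.univ.map f = S),
      ∏ k, v (f k) = ∏ i ∈ S, v i := by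
    intro f hf
    rw [Finset.mem_filter] at hf
    rw [← hf.2, Finset.prod_map]
  rw [Finset.sum_congr rfl h1, Finset.sum_const, nsmul_eq_mul]
  congr 2
  have hc : Fintype.card (Fin m ≃ S) = m.factorial := by
    rw [Fintype.card_equiv (S.equivFinOfCardEq hS.2).symm, Fintype.card_fin]
  rw [← hc, ← Finset.card_univ]
  symm
  refine Finset.card_bij (fun g _ => g.toEmbedding.trans (Function.Embedding.subtype _)) ?_ ?_ ?_
  · intro g _
    simp only [Finset.mem_filter, Finset.mem_univ, true_and]
    ext i
    simp only [Finset.mem_map, Finset.mem_univ, true_and]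
    constructor
    · rintro ⟨k, rfl⟩; exact (g k).2
    · intro hi; exact ⟨g.symm ⟨i, hi⟩, by simp⟩
  · intro g _ g' _ h
    ext k
    have := DFunLike.congr_fun h k
    simpa using congrArg Fin.val this
  · intro f hf
    simp only [Finset.mem_filter, Finset.mem_univ, true_and] at hf
    have hmem : ∀ k, f k ∈ S := fun k => by rw [← hf]; simp
    refine ⟨Equiv.ofBijective (fun k => (⟨f k, hmem k⟩ : S)) ⟨?_, ?_⟩, Finset.mem_univ _, ?_⟩
    · intro a b h; exact f.injective (congrArg Subtype.val h)
    · rintro ⟨i, hi⟩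
      rw [← hf] at hi
      simp only [Finset.mem_map, Finset.mem_univ, true_and] at hi
      obtain ⟨k, hk⟩ := hi
      exact ⟨k, Subtype.ext hk⟩
    · ext k; rfl

lemma alternating_superset {m : ℕ} (A : Finset (Fin m)) :
    ∑ T ∈ (Finset.univ : Finset (Finset (Fin m))).filter (fun T => A ⊆ T),
      (-1 : ℂ) ^ (m - T.card) = if A = Finset.univ then 1 else 0 := by
  classical
  have h1 : ∑ T ∈ (Finset.univ : Finset (Finset (Fin m))).filter (fun T => A ⊆ T),
      (-1 : ℂ) ^ (m - T.card) = ∑ U ∈ Aᶜ.powerset, (-1 : ℂ) ^ U.card := by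
    refine Finset.sum_bij' (fun T _ => Tᶜ) (fun U _ => Uᶜ) ?_ ?_ ?_ ?_ ?_
    · intro T hT; simp at hT ⊢; exact hT
    · intro U hU; simp at hU ⊢; exact Finset.subset_compl_comm.1 hU
    · intro T _; simp
    · intro U _; simp
    · intro T _; rw [Finset.card_compl, Fintype.card_fin]
  rw [h1]
  have h2 := Finset.sum_powerset_neg_one_pow_card (x := Aᶜ)
  have h3 : ((∑ U ∈ Aᶜ.powerset, (-1 : ℤ) ^ U.card : ℤ) : ℂ) = ∑ U ∈ Aᶜ.powerset, (-1 : ℂ) ^ U.card := by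
    push_cast; rfl
  rw [← h3, h2]
  by_cases hA : A = Finset.univ
  · simp [hA]
  · rw [if_neg hA, if_neg]; simp
    simpa using hA

lemma polarization {V : Type*} [AddCommGroup V] [Module ℂ V] {m : ℕ}
    (M : MultilinearMap ℂ (fun _ : Fin m => V) ℂ)
    (hsym : ∀ (σ : Equiv.Perm (Fin m)) v, M (fun i => v (σ i)) = M v) (x : Fin m → V) :
    ∑ T : Finset (Fin m), (-1 : ℂ) ^ (m - T.card) * M (fun _ => ∑ j ∈ T, x j)
      = m.factorial * M x := by
  classical
  have h1 : ∀ T : Finset (Fin m), M (fun _ => ∑ j ∈ T, x j)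
      = ∑ r : Fin m → Fin m, if Finset.univ.image r ⊆ T then M (fun i => x (r i)) else 0 := by
    intro T
    rw [M.map_sum_finset (fun _ j => x j) (fun _ => T), ← Finset.sum_filter]
    refine Finset.sum_congr ?_ fun _ _ => rfl
    ext r
    simp [Fintype.mem_piFinset, Finset.image_subset_iff]
  simp_rw [h1, Finset.mul_sum]
  rw [Finset.sum_comm]
  have h2 : ∀ r : Fin m → Fin m,
      ∑ T : Finset (Fin m), (-1 : ℂ) ^ (m - T.card) *
        (if Finset.univ.image r ⊆ T then M (fun i => x (r i)) else 0)
      = if Function.Bijective r then M x else 0 := by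
    intro r
    simp_rw [mul_ite, mul_zero]
    rw [← Finset.sum_filter, ← Finset.sum_mul, alternating_superset]
    have h3 : Finset.univ.image r = Finset.univ ↔ Function.Bijective r := by
      rw [← Finite.surjective_iff_bijective, Finset.eq_univ_iff_forall]
      simp [Function.Surjective]
    by_cases hr : Function.Bijective r
    · rw [if_pos (h3.2 hr), if_pos hr, one_mul]
      exact hsym (Equiv.ofBijective r hr) x
    · rw [if_neg (fun h => hr (h3.1 h)), if_neg hr, zero_mul]
  rw [Finset.sum_congr rfl fun r _ => h2 r, ← Finset.sum_filter, Finset.sum_const, nsmul_eq_mul]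
  congr 2
  rw [← Fintype.card_subtype, Fintype.card_congr Equiv.bijectiveEquiv,
    Fintype.card_equiv (Equiv.refl _), Fintype.card_fin]

/-- The inclusion of real vectors into complex vectors. -/
noncomputable def toC (n : ℕ) : (Fin n → ℝ) →ₗ[ℝ] (Fin n → ℂ) where
  toFun x := fun i => (x i : ℂ)
  map_add' x y := by funext i; simp
  map_smul' c x := by funext i; simp

lemma toC_apply {n : ℕ} (x : Fin n → ℝ) (i : Fin n) : toC n x i = (x i : ℂ) := rfl

lemma gsymm_toC {n m : ℕ} (x : Fin n → ℝ) : gsymm (toC n x) m = (esymm x m : ℂ) := by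
  simp [gsymm, esymm, toC_apply]

lemma symForm_toC {n m : ℕ} (x : Fin n → ℝ) :
    symForm n m (fun _ => toC n x) = ((m.factorial * esymm x m : ℝ) : ℂ) := by
  rw [symForm_diag, gsymm_toC]; push_cast; rfl

lemma symForm_polarized {n m : ℕ} (hm : 1 ≤ m) (x : Fin m → Fin n → ℝ) :
    symForm n m (fun j => toC n (x j)) = ((m.factorial * polarizedEsymm x : ℝ) : ℂ) := by
  classical
  have hf : (m.factorial : ℂ) ≠ 0 := by exact_mod_cast m.factorial_ne_zero
  have h := polarization (symForm n m) symForm_symm (fun j => toC n (x j))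
  simp_rw [← map_sum, symForm_toC] at h
  apply mul_left_cancel₀ hf
  rw [← h, polarizedEsymm]
  have h0 : esymm (∑ j ∈ (∅ : Finset (Fin m)), x j) m = 0 := by
    rw [esymm]
    refine Finset.sum_eq_zero fun S hS => ?_
    rw [Finset.mem_powersetCard] at hS
    have : S.Nonempty := Finset.card_pos.1 (by omega)
    obtain ⟨i, hi⟩ := this
    exact Finset.prod_eq_zero hi (by simp)
  have h1 : ∑ T ∈ (Finset.univ : Finset (Finset (Fin m))).filter (fun T => T ≠ ∅),
      (-1 : ℝ) ^ (m - T.card) * esymm (∑ j ∈ T, x j) m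
      = ∑ T : Finset (Fin m), (-1 : ℝ) ^ (m - T.card) * esymm (∑ j ∈ T, x j) m := by
    refine Finset.sum_subset (Finset.filter_subset _ _) fun T _ hT => ?_
    have : T = ∅ := by simpa using hT
    rw [this, h0, mul_zero]
  rw [h1]
  push_cast
  rw [mul_inv_cancel_left₀ hf, Finset.mul_sum]
  refine Finset.sum_congr rfl fun T _ => ?_
  ring

lemma continuous_esymm {n m : ℕ} : Continuous fun x : Fin n → ℝ => esymm x m := by
  unfold esymm; fun_prop

lemma continuous_symForm_diag {n m : ℕ} :
    Continuous fun v : Fin n → ℂ => symForm n m (fun _ => v) := by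
  simp_rw [symForm_apply]; fun_prop

lemma mixed_strict {n m : ℕ} (hm : 1 ≤ m) (hmn : m ≤ n) (x z : Fin m → Fin n → ℝ) (δ : ℝ)
    (hδ : 0 < δ) (hxz : ∀ j, x j = z j + δ • (fun _ => (1:ℝ)))
    (hz : ∀ j, ∀ t : ℝ, 0 ≤ t → 0 < esymm (z j + t • (fun _ => (1:ℝ))) m) :
    0 < polarizedEsymm x ∧ ∏ j, esymm (x j) m ≤ polarizedEsymm x ^ m := by
  classical
  set e : Fin n → ℝ := fun _ => 1 with he_def
  have hfpos : (0:ℝ) < m.factorial := by exact_mod_cast m.factorial_pos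
  have hesymm0 : ∀ v : Fin n → ℝ, symForm n m (fun _ => toC n v) ≠ 0 ↔ esymm v m ≠ 0 := by
    intro v
    rw [symForm_toC]
    rw [Complex.ofReal_ne_zero, mul_ne_zero_iff]
    exact ⟨fun h => h.2, fun h => ⟨hfpos.ne', h⟩⟩
  have he : ∀ y, ∀ α : ℝ, 0 < α →
      symForm n m (fun _ => toC n y + Complex.I • toC n (α • e)) ≠ 0 := by
    intro y α hα
    rw [symForm_diag]
    refine mul_ne_zero (by exact_mod_cast m.factorial_ne_zero) ?_
    have := gsymm_hyperbolic hmn y (Complex.I * α) (by simpa using hα)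
    convert this using 2
    funext i
    simp [toC_apply, he_def]
  have hst := cone_stable (toC n) (symForm n m) continuous_symForm_diag e z he
    (fun j t ht => (hesymm0 _).2 (hz j t ht).ne') Finset.univ
  let C : Set (Fin n → ℝ) :=
    {w | ∃ α : ℝ, 0 < α ∧ ∃ σ : Fin m → ℝ, (∀ j, 0 ≤ σ j) ∧ w = α • e + ∑ j, σ j • z j}
  have hCst : ∀ y, ∀ w ∈ C, symForm n m (fun _ => toC n y + Complex.I • toC n w) ≠ 0 := by
    rintro y _ ⟨α, hα, σ, hσ, rfl⟩
    exact hst y α hα σ hσ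
  have hCne : ∀ w ∈ C, esymm w m ≠ 0 := by
    intro w hw
    have h1 := hCst 0 w hw
    rw [map_zero, zero_add, const_smul_eval] at h1
    exact (hesymm0 _).1 (right_ne_zero_of_mul h1)
  have hadd : ∀ w ∈ C, ∀ w' ∈ C, w + w' ∈ C := by
    rintro _ ⟨α, hα, σ, hσ, rfl⟩ _ ⟨β, hβ, τ, hτ, rfl⟩
    refine ⟨α + β, by linarith, fun j => σ j + τ j, fun j => add_nonneg (hσ j) (hτ j), ?_⟩
    simp_rw [add_smul, Finset.sum_add_distrib]
    abel
  have hsmul : ∀ c : ℝ, 0 < c → ∀ w ∈ C, c • w ∈ C := by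
    rintro c hc _ ⟨α, hα, σ, hσ, rfl⟩
    refine ⟨c * α, mul_pos hc hα, fun j => c * σ j, fun j => mul_nonneg hc.le (hσ j), ?_⟩
    simp_rw [mul_smul, ← Finset.smul_sum, smul_add]
  have hee : ∀ α : ℝ, 0 < α → 0 < esymm (α • e) m := by
    intro α hα
    have h1 := gsymm_pos_shift hmn (fun _ : Fin n => (0:ℝ)) (fun k _ _ =>
      Finset.sum_nonneg fun S _ => Finset.prod_nonneg fun i _ => le_rfl) α hα
    have h2 : (α • e) = fun _ : Fin n => 0 + α := by funext i; simp [he_def]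
    rw [h2]; exact h1
  have hCpos : ∀ w ∈ C, 0 < esymm w m := by
    rintro _ ⟨α, hα, σ, hσ, rfl⟩
    by_contra hneg
    push Not at hneg
    let φ : ℝ → ℝ := fun γ => esymm (α • e + γ • ∑ j, σ j • z j) m
    have hφ : Continuous φ := continuous_esymm.comp (by fun_prop)
    have h0 : 0 < φ 0 := by simpa [φ] using hee α hα
    have h1 : φ 1 ≤ 0 := by simpa [φ] using hneg
    obtain ⟨γ, hγ, hγ'⟩ := intermediate_value_Icc' (zero_le_one) hφ.continuousOn ⟨h1, h0.le⟩
    refine hCne _ ⟨α, hα, fun j => γ * σ j, fun j => mul_nonneg hγ.1 (hσ j), rfl⟩ ?_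
    simp_rw [mul_smul, ← Finset.smul_sum]
    exact hγ'
  have hpos : ∀ a ∈ C, ∃ r : ℝ, 0 < r ∧ symForm n m (fun _ => toC n a) = r :=
    fun a ha => ⟨_, mul_pos hfpos (hCpos a ha), symForm_toC a⟩
  have hxC : ∀ j, x j ∈ C := by
    intro j
    refine ⟨δ, hδ, fun i => if i = j then 1 else 0, fun i => by dsimp only; split_ifs <;> norm_num, ?_⟩
    rw [hxz j]
    simp [he_def, add_comm]
  obtain ⟨h1, h2⟩ := garding_main (toC n) C hadd hsmul m (symForm n m) symForm_symm hpos hCst x hxC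
  obtain ⟨r, hr, hr'⟩ := h1 (by omega)
  rw [symForm_polarized hm] at hr' h2
  have hr2 : m.factorial * polarizedEsymm x = r := by exact_mod_cast hr'
  have hP : 0 < polarizedEsymm x := by
    rw [← hr2] at hr
    exact (mul_pos_iff_of_pos_left hfpos).1 hr
  refine ⟨hP, ?_⟩
  simp_rw [symForm_toC, Complex.norm_real] at h2
  rw [Finset.prod_congr rfl (fun j _ => Real.norm_of_nonneg
    (mul_pos hfpos (hCpos _ (hxC j))).le), Real.norm_of_nonneg (mul_pos hfpos hP).le,
    Finset.prod_mul_distrib, Finset.prod_const, mul_pow] at h2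
  simp only [Finset.card_univ, Fintype.card_fin] at h2
  exact le_of_mul_le_mul_left h2 (by positivity)

end concrete

/-- Mixed Gårding inequality for vectors: if each `xʲ` satisfies `e_k(xʲ) ≥ 0`
for `k = 1,…,m`, then `Ẽ_m(x¹,…,xᵐ) ≥ 0` and
`Ẽ_m(x¹,…,xᵐ)^m ≥ e_m(x¹) ⋯ e_m(xᵐ)`. -/
theorem mixed_garding_vectors {n m : ℕ} (hn : 1 ≤ n) (hm : 1 ≤ m) (hmn : m ≤ n)
    (x : Fin m → (Fin n → ℝ))
    (hx : ∀ j, ∀ k, 1 ≤ k → k ≤ m → 0 ≤ esymm (x j) k) :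
    0 ≤ polarizedEsymm x ∧ polarizedEsymm x ^ m ≥ ∏ j, esymm (x j) m := by
  classical
  set e : Fin n → ℝ := fun _ => 1 with he_def
  have key : ∀ ε : ℝ, 0 < ε → 0 < polarizedEsymm (fun j => x j + ε • e) ∧
      ∏ j, esymm (x j + ε • e) m ≤ polarizedEsymm (fun j => x j + ε • e) ^ m := by
    intro ε hε
    refine mixed_strict hm hmn (fun j => x j + ε • e) (fun j => x j + (ε / 2) • e) (ε / 2)
      (by linarith) (fun j => ?_) (fun j t ht => ?_)
    · rw [add_assoc, ← he_def, ← add_smul, add_halves]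
    · have h1 := gsymm_pos_shift hmn (x j) (hx j) (ε / 2 + t) (by linarith)
      have h2 : x j + (ε / 2) • e + t • (fun _ => (1:ℝ)) = fun i => x j i + (ε / 2 + t) := by
        funext i; simp [he_def]; ring
      rw [h2]; exact h1
  have hlim : ∀ f : ℝ → ℝ, Continuous f → (∀ ε, 0 < ε → 0 ≤ f ε) → 0 ≤ f 0 := by
    intro f hf h
    have h1 : Filter.Tendsto f (nhdsWithin 0 (Set.Ioi 0)) (nhds (f 0)) :=
      hf.continuousAt.tendsto.mono_left nhdsWithin_le_nhds
    exact ge_of_tendsto h1 (Filter.eventually_of_mem self_mem_nhdsWithin fun ε hε => h ε hε)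
  have hcs : ∀ j, Continuous fun ε : ℝ => esymm (x j + ε • e) m := fun j =>
    continuous_esymm.comp (by fun_prop)
  have hcp : Continuous fun ε : ℝ => polarizedEsymm (fun j => x j + ε • e) := by
    unfold polarizedEsymm
    refine continuous_const.mul (continuous_finsetSum _ fun T _ => continuous_const.mul ?_)
    exact continuous_esymm.comp (by fun_prop)
  constructor
  · have := hlim _ hcp fun ε hε => (key ε hε).1.le
    simpa using this
  · have := hlim (fun ε => polarizedEsymm (fun j => x j + ε • e) ^ m - ∏ j, esymm (x j + ε • e) m)
      ((hcp.pow m).sub (continuous_finsetProd _ fun j _ => hcs j))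
      fun ε hε => sub_nonneg.2 (key ε hε).2
    simpa using this
end

section
/- Mixed Gårding inequality for Hermitian matrices: let A_1,…,A_m be n×n complex Hermitian matrices with σ_k(A_j) ≥ 0 for every k = 1,…,m and every j = 1,…,m. Then D_m(A_1,…,A_m)^m ≥ σ_m(A_1) · σ_m(A_2) ⋯ σ_m(A_m). -/
/-- `σ_k(A)`: the `k`-th elementary symmetric polynomial of the real eigenvalues
(with multiplicity) of the Hermitian matrix `A` (with `σ_0 = 1`). -/
noncomputable def sigmaH {n : ℕ} {A : Matrix (Fin n) (Fin n) ℂ}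
    (hA : A.IsHermitian) (k : ℕ) : ℝ :=
  ∑ S ∈ Finset.powersetCard k (Finset.univ : Finset (Fin n)), ∏ i ∈ S, hA.eigenvalues i

theorem isHermitian_finsetSum {n : ℕ} {ι : Type*} (A : ι → Matrix (Fin n) (Fin n) ℂ)
    (hA : ∀ j, (A j).IsHermitian) (T : Finset ι) : (∑ j ∈ T, A j).IsHermitian := by
  unfold Matrix.IsHermitian
  rw [Matrix.conjTranspose_sum]
  exact Finset.sum_congr rfl fun j _ => hA j

/-- The polarized `m`-th Hessian form
`D_m(A₁,…,A_m) = (1/m!) ∑_{∅ ≠ T ⊆ {1,…,m}} (−1)^{m−|T|} σ_m(∑_{j∈T} A_j)`. -/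
noncomputable def Dpol {n m : ℕ} (A : Fin m → Matrix (Fin n) (Fin n) ℂ)
    (hA : ∀ j, (A j).IsHermitian) : ℝ :=
  (m.factorial : ℝ)⁻¹ *
    ∑ T ∈ (Finset.univ : Finset (Finset (Fin m))).filter (fun T => T ≠ ∅),
      (-1 : ℝ) ^ (m - T.card) * sigmaH (isHermitian_finsetSum A hA T) m

open Polynomial in
/-- The polynomial `t ↦ M(x + t a, …, x + t a)`. -/
noncomputable def garLine {W : Type*} [AddCommGroup W] [Module ℂ W] {m : ℕ}
    (M : MultilinearMap ℂ (fun _ : Fin m => W) ℂ) (x a : W) : Polynomial ℂ :=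
  ∑ S : Finset (Fin m), Polynomial.C (M (S.piecewise (fun _ => a) (fun _ => x))) * X ^ S.card

theorem garLine_eval {W : Type*} [AddCommGroup W] [Module ℂ W] {m : ℕ}
    (M : MultilinearMap ℂ (fun _ : Fin m => W) ℂ) (x a : W) (t : ℂ) :
    (garLine M x a).eval t = M (fun _ => x + t • a) := by
  have h : (fun _ : Fin m => x + t • a) = (fun _ => t • a) + (fun _ => x) := by
    funext i; simp [add_comm]
  rw [h, MultilinearMap.map_add_univ, garLine, Polynomial.eval_finsetSum]
  refine Finset.sum_congr rfl fun S _ => ?_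
  have h2 : S.piecewise (fun _ : Fin m => t • a) (fun _ => x) =
      S.piecewise (fun i => (fun _ => t) i • (S.piecewise (fun _ => a) (fun _ => x) : Fin m → W) i)
        (S.piecewise (fun _ => a) (fun _ => x)) := by
    funext i; by_cases hi : i ∈ S <;> simp [hi]
  rw [h2, MultilinearMap.map_piecewise_smul]
  simp only [Finset.prod_const, smul_eq_mul, Polynomial.eval_mul, Polynomial.eval_C,
    Polynomial.eval_pow, Polynomial.eval_X]
  rw [mul_comm]

theorem garLine_natDegree {W : Type*} [AddCommGroup W] [Module ℂ W] {m : ℕ}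
    (M : MultilinearMap ℂ (fun _ : Fin m => W) ℂ) (x a : W) :
    (garLine M x a).natDegree ≤ m := by
  refine Polynomial.natDegree_sum_le_of_forall_le _ _ fun S _ => ?_
  refine (Polynomial.natDegree_C_mul_X_pow_le _ _).trans ?_
  simpa using Finset.card_le_univ S

theorem garLine_coeff_top {W : Type*} [AddCommGroup W] [Module ℂ W] {m : ℕ}
    (M : MultilinearMap ℂ (fun _ : Fin m => W) ℂ) (x a : W) :
    (garLine M x a).coeff m = M (fun _ => a) := by
  rw [garLine, Polynomial.finsetSum_coeff]
  rw [Finset.sum_eq_single Finset.univ]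
  · simp
  · intro S _ hS
    have : m ≠ S.card := by
      intro h
      apply hS
      rw [← Finset.card_eq_iff_eq_univ]
      simp [← h]
    simp [Polynomial.coeff_X_pow, this]
  · simp

/-- Symmetry of a multilinear form. -/
def garSymm {W : Type*} [AddCommGroup W] [Module ℂ W] {m : ℕ}
    (M : MultilinearMap ℂ (fun _ : Fin m => W) ℂ) : Prop :=
  ∀ (σ : Equiv.Perm (Fin m)) (v : Fin m → W), M (fun i => v (σ i)) = M v

theorem garLine_coeff_one {W : Type*} [AddCommGroup W] [Module ℂ W] {m : ℕ}
    (M : MultilinearMap ℂ (fun _ : Fin (m + 1) => W) ℂ) (hM : garSymm M) (x a : W) :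
    (garLine M x a).coeff 1 = (m + 1) * M (Fin.cons a (fun _ => x)) := by
  rw [garLine, Polynomial.finsetSum_coeff]
  have : ∀ S : Finset (Fin (m + 1)), (Polynomial.C (M (S.piecewise (fun _ => a) (fun _ => x))) *
      Polynomial.X ^ S.card).coeff 1 =
      if S ∈ Finset.univ.map ⟨fun i : Fin (m+1) => ({i} : Finset (Fin (m+1))), Finset.singleton_injective⟩
      then M (Fin.cons a (fun _ => x)) else 0 := by
    intro S
    by_cases hS : S.card = 1
    · obtain ⟨i, rfl⟩ := Finset.card_eq_one.1 hS
      simp only [Finset.card_singleton, pow_one, Polynomial.coeff_C_mul, Polynomial.coeff_X_one, mul_one]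
      rw [if_pos (by simp)]
      rw [← hM (Equiv.swap 0 i) (Fin.cons a (fun _ => x))]
      congr 1
      funext j
      by_cases hj : j = i
      · subst hj; simp
      · by_cases hj0 : j = 0
        · subst hj0
          simp only [Equiv.swap_apply_left]
          obtain ⟨k, rfl⟩ := Fin.exists_succ_eq.2 (Ne.symm hj)
          simp [hj]
        · obtain ⟨k, rfl⟩ := Fin.exists_succ_eq.2 hj0
          rw [Equiv.swap_apply_of_ne_of_ne hj0 hj]
          simp [hj]
    · rw [if_neg]
      · simp [Polynomial.coeff_X_pow, Ne.symm hS]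
      · intro h
        simp only [Finset.mem_map, Finset.mem_univ, true_and, Function.Embedding.coeFn_mk] at h
        obtain ⟨i, rfl⟩ := h
        simp at hS
  rw [Finset.sum_congr rfl fun S _ => this S]
  rw [Finset.sum_ite_mem]
  simp

theorem gar_hasDerivAt {W : Type*} [AddCommGroup W] [Module ℂ W] {m : ℕ}
    (M : MultilinearMap ℂ (fun _ : Fin (m + 1) => W) ℂ) (hM : garSymm M) (x a : W) (t : ℂ) :
    HasDerivAt (fun s : ℂ => M (fun _ => x + s • a))
      ((m + 1) * M (Fin.cons a (fun _ => x + t • a))) t := by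
  have h := (garLine M (x + t • a) a).hasDerivAt (t - t)
  have h2 := HasDerivAt.comp (h := fun s : ℂ => s - t) t h ((hasDerivAt_id t).sub_const t)
  simp only [sub_self, mul_one] at h2
  rw [← Polynomial.coeff_zero_eq_eval_zero, Polynomial.coeff_derivative, zero_add,
    garLine_coeff_one M hM] at h2
  simp only [Nat.cast_zero, zero_add, mul_one] at h2
  refine h2.congr_of_eventuallyEq (Filter.Eventually.of_forall fun s => ?_)
  simp only [Function.comp, garLine_eval]
  congr 1
  funext _
  rw [sub_smul]; abel

theorem gar_factor {W : Type*} [AddCommGroup W] [Module ℂ W] {m : ℕ}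
    (M : MultilinearMap ℂ (fun _ : Fin m => W) ℂ) (x a : W) (ha : M (fun _ => a) ≠ 0) :
    ∃ r : Fin m → ℂ, ∀ t : ℂ, M (fun _ => x + t • a) = M (fun _ => a) * ∏ i, (t - r i) := by
  have hdeg : (garLine M x a).natDegree = m :=
    Polynomial.natDegree_eq_of_le_of_coeff_ne_zero (garLine_natDegree M x a)
      (by rwa [garLine_coeff_top])
  have hs := IsAlgClosed.splits (garLine M x a)
  have hcard := hs.natDegree_eq_card_roots
  have hlc : (garLine M x a).leadingCoeff = M (fun _ => a) := by
    rw [Polynomial.leadingCoeff, hdeg, garLine_coeff_top]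
  have hfac := hs.eq_prod_roots
  obtain ⟨l, hl⟩ := Quot.exists_rep (garLine M x a).roots
  have hl' : (l : Multiset ℂ) = (garLine M x a).roots := hl
  have hlen : l.length = m := by
    rw [← Multiset.coe_card, hl', ← hcard, hdeg]
  subst hlen
  refine ⟨l.get, fun t => ?_⟩
  rw [← garLine_eval]
  conv_lhs => rw [hfac, hlc, ← hl']
  rw [Polynomial.eval_mul, Polynomial.eval_C]
  congr 1
  simp [Polynomial.eval_list_prod, List.map_map, Function.comp_def]

theorem gar_factor_deriv {W : Type*} [AddCommGroup W] [Module ℂ W] {m : ℕ}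
    (M : MultilinearMap ℂ (fun _ : Fin (m + 1) => W) ℂ) (hM : garSymm M) (x a : W)
    (r : Fin (m + 1) → ℂ)
    (hr : ∀ t : ℂ, M (fun _ => x + t • a) = M (fun _ => a) * ∏ i, (t - r i)) 
    (hx : M (fun _ => x) ≠ 0) :
    (m + 1) * M (Fin.cons a (fun _ => x)) = M (fun _ => x) * ∑ i, (- r i)⁻¹ := by
  have h1 := gar_hasDerivAt M hM x a 0
  simp only [zero_smul, add_zero] at h1
  have h0 := hr 0
  simp only [zero_smul, add_zero, zero_sub] at h0
  have hri : ∀ i, - r i ≠ 0 := by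
    intro i hi
    apply hx
    rw [h0, Finset.prod_eq_zero (Finset.mem_univ i) hi, mul_zero]
  have h2 : HasDerivAt (fun t : ℂ => M (fun _ => a) * ∏ i, (t - r i)) _ 0 :=
    (HasDerivAt.fun_finsetProd (u := Finset.univ) (f := fun i t => t - r i) (f' := fun _ => 1)
      (fun i _ => (hasDerivAt_id (0:ℂ)).sub_const (r i))).const_mul (M (fun _ => a))
  have h3 := h1.unique (h2.congr_of_eventuallyEq (Filter.Eventually.of_forall hr))
  rw [h3, h0, mul_assoc]
  refine congrArg (M (fun _ => a) * ·) ?_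
  rw [Finset.mul_sum]
  refine Finset.sum_congr rfl fun i _ => ?_
  rw [← Finset.mul_prod_erase _ _ (Finset.mem_univ i)]
  simp only [zero_sub, smul_eq_mul, mul_one]
  rw [mul_comm (-r i), mul_assoc, mul_inv_cancel₀ (hri i), mul_one]

theorem gar_smul {W : Type*} [AddCommGroup W] [Module ℂ W] {m : ℕ}
    (M : MultilinearMap ℂ (fun _ : Fin m => W) ℂ) (c : ℂ) (x : W) :
    M (fun _ => c • x) = c ^ m * M (fun _ => x) := by
  have := M.map_smul_univ (fun _ => c) (fun _ => x)
  simpa using this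

/-- A real form `V` (a real subspace) together with a convex cone `C` inside it. -/
structure GarCone {W : Type*} [AddCommGroup W] [Module ℂ W] (V C : Set W) : Prop where
  vadd : ∀ x ∈ V, ∀ y ∈ V, x + y ∈ V
  vsmul : ∀ r : ℝ, ∀ x ∈ V, (r : ℂ) • x ∈ V
  sub : C ⊆ V
  cadd : ∀ x ∈ C, ∀ y ∈ C, x + y ∈ C
  csmul : ∀ r : ℝ, 0 < r → ∀ x ∈ C, (r : ℂ) • x ∈ C

/-- Stability of the form `M` over the tube `V + i C`. -/
def garStab {W : Type*} [AddCommGroup W] [Module ℂ W] {m : ℕ}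
    (M : MultilinearMap ℂ (fun _ : Fin m => W) ℂ) (V C : Set W) : Prop :=
  ∀ x ∈ V, ∀ y ∈ C, M (fun _ => x + Complex.I • y) ≠ 0

theorem garStab_ne {W : Type*} [AddCommGroup W] [Module ℂ W] {m : ℕ}
    {M : MultilinearMap ℂ (fun _ : Fin m => W) ℂ} {V C : Set W} (hC : GarCone V C)
    (hM : garStab M V C) {y : W} (hy : y ∈ C) : M (fun _ => y) ≠ 0 := by
  intro h
  have h0 : (0 : W) ∈ V := by simpa using hC.vsmul 0 y (hC.sub hy)
  apply hM 0 h0 y hy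
  simp only [zero_add]
  rw [gar_smul, h, mul_zero]

theorem gar_split {W : Type*} [AddCommGroup W] [Module ℂ W] (x a : W) (u : ℂ) :
    x + u • a = (x + (u.re : ℂ) • a) + Complex.I • ((u.im : ℂ) • a) := by
  conv_lhs => rw [← Complex.re_add_im u]
  rw [add_smul, smul_smul, mul_comm Complex.I, add_assoc]

/-- Gauss–Lucas: stability passes to the polar derivative in a direction of the cone. -/
theorem garStab_curryLeft {W : Type*} [AddCommGroup W] [Module ℂ W] {m : ℕ}
    {M : MultilinearMap ℂ (fun _ : Fin (m + 1) => W) ℂ} {V C : Set W} (hC : GarCone V C)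
    (hS : garSymm M) (hM : garStab M V C) {a : W} (ha : a ∈ C) :
    garStab (M.curryLeft a) V C := by
  intro x hx y hy h0
  rw [MultilinearMap.curryLeft_apply] at h0
  obtain ⟨r, hr⟩ := gar_factor M (x + Complex.I • y) a (garStab_ne hC hM ha)
  have hd := gar_factor_deriv M hS _ a r hr (hM x hx y hy)
  rw [h0, mul_zero, eq_comm, mul_eq_zero, or_iff_right (hM x hx y hy)] at hd
  have him : ∀ i, (r i).im < 0 := by
    intro i
    by_contra hi
    push Not at hi
    have h1 := hr (r i)
    rw [Finset.prod_eq_zero (Finset.mem_univ i) (sub_self _), mul_zero] at h1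
    have h2 : x + Complex.I • y + r i • a =
        (x + ((r i).re : ℂ) • a) + Complex.I • (y + ((r i).im : ℂ) • a) := by
      rw [gar_split, smul_add]; abel
    rw [h2] at h1
    refine hM _ (hC.vadd _ hx _ (hC.vsmul _ _ (hC.sub ha))) _ ?_ h1
    rcases hi.eq_or_lt with h | h
    · rw [← h]; simpa using hy
    · exact hC.cadd _ hy _ (hC.csmul _ h _ ha)
  have hlt : (∑ i, (-r i)⁻¹).im < 0 := by
    rw [Complex.im_sum]
    refine Finset.sum_neg (fun i _ => ?_) Finset.univ_nonempty
    rw [Complex.inv_im]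
    have h1 := him i
    have h2 : 0 < Complex.normSq (-r i) := by
      rw [Complex.normSq_pos]
      intro h
      rw [neg_eq_zero] at h
      rw [h] at h1
      simp at h1
    apply div_neg_of_neg_of_pos _ h2
    simpa using h1
  rw [hd] at hlt
  simp at hlt

theorem gar_root_real {W : Type*} [AddCommGroup W] [Module ℂ W] {m : ℕ}
    {M : MultilinearMap ℂ (fun _ : Fin m => W) ℂ} {V : Set W} {a : W}
    (vadd : ∀ x ∈ V, ∀ y ∈ V, x + y ∈ V) (vsmul : ∀ r : ℝ, ∀ x ∈ V, (r : ℂ) • x ∈ V) (haV : a ∈ V)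
    (hyp : ∀ x ∈ V, ∀ α : ℝ, 0 < α → M (fun _ => x + Complex.I • ((α : ℂ) • a)) ≠ 0)
    {x : W} (hx : x ∈ V) (hpos : ∀ t : ℝ, 0 ≤ t → M (fun _ => x + (t : ℂ) • a) ≠ 0) {u : ℂ}
    (hu : M (fun _ => x + u • a) = 0) : u.im = 0 ∧ u.re < 0 := by
  have him : u.im = 0 := by
    rcases lt_trichotomy u.im 0 with h | h | h
    · exfalso
      have h1 : M (fun _ => (-1 : ℂ) • (x + u • a)) = 0 := by rw [gar_smul, hu, mul_zero]
      rw [gar_split] at h1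
      refine hyp (((-1 : ℝ) : ℂ) • (x + (u.re : ℂ) • a)) (vsmul _ _ (vadd _ hx _ (vsmul _ _ haV)))
        (-u.im) (by linarith) ?_
      rw [← h1]
      congr 1
      funext _
      simp
    · exact h
    · exfalso
      rw [gar_split] at hu
      exact hyp _ (vadd _ hx _ (vsmul _ _ haV)) _ h hu
  refine ⟨him, ?_⟩
  by_contra h
  push Not at h
  apply hpos _ h
  rw [← hu]
  have : (u.re : ℂ) = u := by apply Complex.ext <;> simp [him]
  rw [this]

theorem gar_factor_real {W : Type*} [AddCommGroup W] [Module ℂ W] {m : ℕ}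
    {M : MultilinearMap ℂ (fun _ : Fin m => W) ℂ} {V : Set W} {a : W}
    (vadd : ∀ x ∈ V, ∀ y ∈ V, x + y ∈ V) (vsmul : ∀ r : ℝ, ∀ x ∈ V, (r : ℂ) • x ∈ V) (haV : a ∈ V)
    (hyp : ∀ x ∈ V, ∀ α : ℝ, 0 < α → M (fun _ => x + Complex.I • ((α : ℂ) • a)) ≠ 0)
    (ha : M (fun _ => a) ≠ 0)
    {x : W} (hx : x ∈ V) (hpos : ∀ t : ℝ, 0 ≤ t → M (fun _ => x + (t : ℂ) • a) ≠ 0) :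
    ∃ l : Fin m → ℝ, (∀ i, 0 < l i) ∧
      ∀ t : ℂ, M (fun _ => x + t • a) = M (fun _ => a) * ∏ i, (t - (-(l i : ℂ))) := by
  obtain ⟨r, hr⟩ := gar_factor M x a ha
  have h : ∀ i, (r i).im = 0 ∧ (r i).re < 0 := by
    intro i
    refine gar_root_real vadd vsmul haV hyp hx hpos ?_
    rw [hr, Finset.prod_eq_zero (Finset.mem_univ i) (sub_self _), mul_zero]
  refine ⟨fun i => -(r i).re, fun i => by linarith [(h i).2], fun t => ?_⟩
  rw [hr]
  congr 1
  refine Finset.prod_congr rfl fun i _ => ?_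
  congr 1
  apply Complex.ext <;> simp [h i]

theorem gar_amgm {m : ℕ} (z : Fin (m + 1) → ℝ) (hz : ∀ i, 0 < z i) :
    ∏ i, z i ≤ ((∑ i, z i) / (m + 1)) ^ (m + 1) := by
  have h := Real.geom_mean_le_arith_mean Finset.univ (fun _ : Fin (m + 1) => (1 : ℝ)) z
    (fun _ _ => zero_le_one) (by simp; positivity) (fun i _ => (hz i).le)
  simp only [Real.rpow_one, Finset.sum_const, Finset.card_univ, Fintype.card_fin, nsmul_eq_mul,
    mul_one, one_mul, Nat.cast_add, Nat.cast_one] at h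
  have hp : 0 ≤ ∏ i, z i := Finset.prod_nonneg fun i _ => (hz i).le
  have h2 := pow_le_pow_left₀ (by positivity) h (m + 1)
  rwa [← Real.rpow_natCast, ← Real.rpow_mul hp, Nat.cast_add, Nat.cast_one,
    inv_mul_cancel₀ (by positivity), Real.rpow_one] at h2

/-- Key inequality `M(a,x,…,x)^{m+1} ≥ M(a,…,a) M(x,…,x)^m`. -/
theorem gar_key {W : Type*} [AddCommGroup W] [Module ℂ W] {m : ℕ}
    {M : MultilinearMap ℂ (fun _ : Fin (m + 1) => W) ℂ} {V C : Set W} (hC : GarCone V C)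
    (hS : garSymm M) (hM : garStab M V C) {a x : W} (ha : a ∈ C) (hx : x ∈ C) (p q : ℝ)
    (hp : 0 < p) (hq : 0 < q) (hpa : M (fun _ => a) = p) (hqx : M (fun _ => x) = q) :
    ∃ s : ℝ, 0 < s ∧ M (Fin.cons a (fun _ => x)) = s ∧ p * q ^ m ≤ s ^ (m + 1) := by
  obtain ⟨l, hl, hr⟩ := gar_factor_real hC.vadd hC.vsmul (hC.sub ha)
    (fun x hx α hα => hM x hx _ (hC.csmul α hα _ ha)) (garStab_ne hC hM ha) (hC.sub hx)
    (fun t ht => by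
      rcases ht.eq_or_lt with h | h
      · rw [← h]; simpa using garStab_ne hC hM hx
      · exact garStab_ne hC hM (hC.cadd _ hx _ (hC.csmul _ h _ ha)))
  have hd := gar_factor_deriv M hS x a _ hr (garStab_ne hC hM hx)
  have h0 := hr 0
  simp only [zero_smul, add_zero, zero_sub, neg_neg] at h0 hd
  rw [hpa, hqx] at h0
  have h0' : q = p * ∏ i, l i := by exact_mod_cast h0
  have hsum : 0 < ∑ i, (l i)⁻¹ := Finset.sum_pos (fun i _ => inv_pos.2 (hl i)) Finset.univ_nonempty
  refine ⟨q * ((∑ i, (l i)⁻¹) / (m + 1)), by positivity, ?_, ?_⟩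
  · rw [hqx] at hd
    have : ((m : ℂ) + 1) ≠ 0 := by exact_mod_cast Nat.succ_ne_zero m
    push_cast
    field_simp
    rw [mul_comm, hd]
    simp
  · have h1 := gar_amgm (fun i => (l i)⁻¹) (fun i => inv_pos.2 (hl i))
    rw [mul_pow]
    calc p * q ^ m = q ^ (m + 1) * ∏ i, (l i)⁻¹ := by
          rw [Finset.prod_inv_distrib]
          have : 0 < ∏ i, l i := Finset.prod_pos fun i _ => hl i
          rw [pow_succ]
          nth_rw 3 [h0']
          field_simp
      _ ≤ _ := by gcongr

theorem garSymm_curryLeft {W : Type*} [AddCommGroup W] [Module ℂ W] {m : ℕ}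
    {M : MultilinearMap ℂ (fun _ : Fin (m + 1) => W) ℂ} (hS : garSymm M) (a : W) :
    garSymm (M.curryLeft a) := by
  intro σ v
  rw [MultilinearMap.curryLeft_apply, MultilinearMap.curryLeft_apply]
  rw [← hS (Equiv.Perm.decomposeFin.symm (0, σ)) (Fin.cons a v)]
  congr 1
  funext i
  refine Fin.cases ?_ (fun j => ?_) i
  · simp
  · simp

/-- The Gårding inequality on an abstract stable cone. -/
theorem gar_mixed {W : Type*} [AddCommGroup W] [Module ℂ W] {V C : Set W} (hC : GarCone V C) :
    ∀ {m : ℕ} (M : MultilinearMap ℂ (fun _ : Fin (m + 1) => W) ℂ), garSymm M → garStab M V C →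
    (∀ y ∈ C, ∃ p : ℝ, 0 < p ∧ M (fun _ => y) = p) →
    ∀ a : Fin (m + 1) → W, (∀ i, a i ∈ C) →
    ∃ s : ℝ, 0 < s ∧ M a = s ∧ ∏ i, (M (fun _ => a i)).re ≤ s ^ (m + 1) := by
  intro m
  induction m with
  | zero =>
    intro M _ _ hpos a ha
    obtain ⟨p, hp, h⟩ := hpos (a 0) (ha 0)
    have : a = fun _ => a 0 := by funext i; congr 1; exact Fin.fin_one_eq_zero i
    refine ⟨p, hp, by rw [← h, ← this], ?_⟩
    simp [h]
  | succ m ih =>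
    intro M hS hM hpos a ha
    have hkey : ∀ x ∈ C, ∃ s : ℝ, 0 < s ∧ M.curryLeft (a 0) (fun _ => x) = s ∧
        (M (fun _ => a 0)).re * (M (fun _ => x)).re ^ (m + 1) ≤ s ^ (m + 2) := by
      intro x hx
      obtain ⟨p, hp, h⟩ := hpos _ (ha 0)
      obtain ⟨q, hq, h'⟩ := hpos _ hx
      obtain ⟨s, hs, h1, h2⟩ := gar_key hC hS hM (ha 0) hx p q hp hq h h'
      refine ⟨s, hs, h1, ?_⟩
      rw [h, h']; exact h2
    obtain ⟨s, hs, h1, h2⟩ := ih (M.curryLeft (a 0)) (garSymm_curryLeft hS _)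
      (garStab_curryLeft hC hS hM (ha 0))
      (fun y hy => by obtain ⟨s, hs, h, -⟩ := hkey y hy; exact ⟨s, hs, h⟩)
      (fun i => a i.succ) (fun i => ha _)
    refine ⟨s, hs, ?_, ?_⟩
    · rw [← h1, MultilinearMap.curryLeft_apply]
      congr 1
      exact (Fin.cons_self_tail a).symm
    · have hre : ∀ i, 0 ≤ (M (fun _ => a i)).re := by
        intro i
        obtain ⟨p, hp, h⟩ := hpos _ (ha i)
        rw [h]; exact hp.le
      rw [← pow_le_pow_iff_left₀ (Finset.prod_nonneg fun i _ => hre i) (by positivity)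
        (Nat.succ_ne_zero m)]
      calc (∏ i, (M (fun _ => a i)).re) ^ (m + 1)
          = ∏ i : Fin (m + 1), ((M (fun _ => a 0)).re * (M (fun _ => a i.succ)).re ^ (m + 1)) := by
            rw [Fin.prod_univ_succ, Finset.prod_mul_distrib, Finset.prod_pow, mul_pow]
            simp
        _ ≤ ∏ i : Fin (m + 1), (M.curryLeft (a 0) (fun _ => a i.succ)).re ^ (m + 2) := by
            refine Finset.prod_le_prod (fun i _ => mul_nonneg (hre _) (pow_nonneg (hre _) _)) ?_
            intro i _
            obtain ⟨s, hs, h, h'⟩ := hkey _ (ha i.succ)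
            rw [h]; exact h'
        _ = (∏ i : Fin (m + 1), (M.curryLeft (a 0) (fun _ => a i.succ)).re) ^ (m + 2) := by
            rw [Finset.prod_pow]
        _ ≤ (s ^ (m + 1)) ^ (m + 2) := by
            refine pow_le_pow_left₀ (Finset.prod_nonneg fun i _ => ?_) h2 _
            obtain ⟨s, hs, h, h'⟩ := hkey _ (ha i.succ)
            rw [h]; exact hs.le
        _ = (s ^ (m + 1 + 1)) ^ (m + 1) := by rw [← pow_mul, ← pow_mul, mul_comm]

/-- Root-continuity argument: roots never cross the real axis along the homotopy. -/
theorem gar_homotopy {W : Type*} [AddCommGroup W] [Module ℂ W] [TopologicalSpace W]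
    [ContinuousAdd W] [ContinuousSMul ℂ W] {m : ℕ}
    (M : MultilinearMap ℂ (fun _ : Fin m => W) ℂ) (hcont : Continuous fun w : Fin m → W => M w)
    (u v z : W) (hz : M (fun _ => z) ≠ 0)
    (H : ∀ s : unitInterval, ∀ t : ℝ, M (fun _ => (v + ((s : ℝ) : ℂ) • u) + (t : ℂ) • z) ≠ 0)
    (H0 : ∀ t : ℂ, M (fun _ => v + t • z) = 0 → t.im < 0) :
    ∀ t : ℂ, M (fun _ => (v + u) + t • z) = 0 → t.im < 0 := by
  set F : unitInterval → ℂ → ℂ := fun s t => M (fun _ => (v + ((s : ℝ) : ℂ) • u) + t • z) with hF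
  have hFc : Continuous (fun p : unitInterval × ℂ => F p.1 p.2) := by
    simp only [hF]
    refine hcont.comp (continuous_pi fun _ => ?_)
    fun_prop
  have hFs : ∀ t, Continuous (fun s => F s t) := fun t =>
    hFc.comp (continuous_id.prodMk continuous_const)
  set S : Set unitInterval := {s | ∃ t : ℂ, 0 ≤ t.im ∧ F s t = 0} with hSdef
  -- openness
  have hopen : IsOpen S := by
    rw [isOpen_iff_mem_nhds]
    rintro s₀ ⟨t₀, ht₀, hs₀⟩
    have hpos : 0 < t₀.im := by
      rcases ht₀.eq_or_lt with h | h
      · exfalso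
        apply H s₀ t₀.re
        have : (t₀.re : ℂ) = t₀ := by apply Complex.ext <;> simp [← h]
        rw [this]; exact hs₀
      · exact h
    have hlt : ‖F s₀ t₀‖ < ‖M (fun _ => z)‖ * t₀.im ^ m := by
      rw [hs₀, norm_zero]
      have := norm_pos_iff.2 hz
      positivity
    have hev := ((hFs t₀).norm.continuousAt (x := s₀)).eventually (gt_mem_nhds hlt)
    filter_upwards [hev] with s hs
    obtain ⟨r, hr⟩ := gar_factor M (v + ((s : ℝ) : ℂ) • u) z hz
    have h1 : F s t₀ = M (fun _ => z) * ∏ i, (t₀ - r i) := hr t₀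
    rw [h1, norm_mul, norm_prod] at hs
    have h2 := lt_of_mul_lt_mul_left hs (norm_nonneg _)
    have h3 : ∃ i, ‖t₀ - r i‖ < t₀.im := by
      by_contra hcon
      push Not at hcon
      have : ∏ _i : Fin m, t₀.im ≤ ∏ i, ‖t₀ - r i‖ :=
        Finset.prod_le_prod (fun _ _ => hpos.le) (fun i _ => hcon i)
      simp only [Finset.prod_const, Finset.card_univ, Fintype.card_fin] at this
      linarith
    obtain ⟨i, hi⟩ := h3
    refine ⟨r i, ?_, ?_⟩
    · have := (Complex.abs_im_le_norm (t₀ - r i)).trans_lt hi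
      rw [Complex.sub_im, abs_lt] at this
      linarith
    · have h4 : F s (r i) = M (fun _ => z) * ∏ j, (r i - r j) := hr (r i)
      rw [h4, Finset.prod_eq_zero (Finset.mem_univ i) (sub_self _), mul_zero]
  -- root bound
  have hbound : ∃ R : ℝ, ∀ s t, F s t = 0 → ‖t‖ ≤ R := by
    have hG : Continuous (fun p : unitInterval × ℂ =>
        M (fun _ => p.2 • (v + ((p.1 : ℝ) : ℂ) • u) + z)) := by
      refine hcont.comp (continuous_pi fun _ => ?_)
      fun_prop
    have hN : IsOpen {p : unitInterval × ℂ |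
        M (fun _ => p.2 • (v + ((p.1 : ℝ) : ℂ) • u) + z) ≠ 0} := isOpen_ne.preimage hG
    obtain ⟨A, B, -, hB, hA1, hB1, hAB⟩ := generalized_tube_lemma
      (isCompact_univ : IsCompact (Set.univ : Set unitInterval))
      (isCompact_singleton : IsCompact ({0} : Set ℂ)) hN (by
        rintro ⟨s, t⟩ ⟨-, ht⟩
        have ht' : t = 0 := ht
        subst ht'
        simpa using hz)
    obtain ⟨ρ, hρ, hball⟩ := Metric.isOpen_iff.1 hB 0 (hB1 rfl)
    refine ⟨ρ⁻¹, fun s t hst => ?_⟩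
    by_contra hcon
    push Not at hcon
    have htpos : 0 < ‖t‖ := (inv_pos.2 hρ).trans hcon
    have ht0 : t ≠ 0 := norm_pos_iff.1 htpos
    have hmem : t⁻¹ ∈ Metric.ball (0 : ℂ) ρ := by
      rw [mem_ball_zero_iff, norm_inv]
      exact inv_lt_of_inv_lt₀ hρ hcon
    have h1 := hAB (Set.mk_mem_prod (hA1 (Set.mem_univ s)) (hball hmem))
    apply h1
    have h2 : (fun _ : Fin m => t⁻¹ • (v + ((s : ℝ) : ℂ) • u) + z) =
        fun _ => t⁻¹ • ((v + ((s : ℝ) : ℂ) • u) + t • z) := by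
      funext _
      rw [smul_add _ _ (t • z), smul_smul, inv_mul_cancel₀ ht0, one_smul]
    change M (fun _ : Fin m => t⁻¹ • (v + ((s : ℝ) : ℂ) • u) + z) = 0
    rw [h2, gar_smul]
    have h3 : M (fun _ => (v + ((s : ℝ) : ℂ) • u) + t • z) = 0 := hst
    rw [h3, mul_zero]
  obtain ⟨R, hR⟩ := hbound
  have hclosed : IsClosed S := by
    have hK : IsCompact ((Set.univ ×ˢ Metric.closedBall (0 : ℂ) R) ∩
        {p : unitInterval × ℂ | 0 ≤ p.2.im ∧ F p.1 p.2 = 0}) := by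
      refine (isCompact_univ.prod (isCompact_closedBall _ _)).inter_right ?_
      refine IsClosed.inter ?_ ?_
      · exact isClosed_le continuous_const (Complex.continuous_im.comp continuous_snd)
      · exact isClosed_eq hFc continuous_const
    have himg : S = Prod.fst '' ((Set.univ ×ˢ Metric.closedBall (0 : ℂ) R) ∩
        {p : unitInterval × ℂ | 0 ≤ p.2.im ∧ F p.1 p.2 = 0}) := by
      ext s
      constructor
      · rintro ⟨t, ht, hst⟩
        exact ⟨(s, t), ⟨⟨trivial, by simpa using hR s t hst⟩, ht, hst⟩, rfl⟩
      · rintro ⟨⟨s', t⟩, ⟨-, ht, hst⟩, rfl⟩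
        exact ⟨t, ht, hst⟩
    rw [himg]
    exact (hK.image continuous_fst).isClosed
  rcases isClopen_iff.1 ⟨hclosed, hopen⟩ with h | h
  · intro t ht
    by_contra hcon
    push Not at hcon
    have : (1 : unitInterval) ∈ S := ⟨t, hcon, by simpa [hF] using ht⟩
    rw [h] at this
    exact this
  · exfalso
    have : (0 : unitInterval) ∈ S := by rw [h]; trivial
    obtain ⟨t, ht, h0⟩ := this
    have := H0 t (by simpa [hF] using h0)
    linarith

/-- Standing data: `M` is hyperbolic in the direction `e` over the real form `V`. -/
structure GarHyp {W : Type*} [AddCommGroup W] [Module ℂ W] [TopologicalSpace W] {m : ℕ}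
    (M : MultilinearMap ℂ (fun _ : Fin m => W) ℂ) (V : Set W) (e : W) : Prop where
  cont : Continuous fun w : Fin m → W => M w
  vadd : ∀ x ∈ V, ∀ y ∈ V, x + y ∈ V
  vsmul : ∀ r : ℝ, ∀ x ∈ V, (r : ℂ) • x ∈ V
  mem : e ∈ V
  ne : M (fun _ => e) ≠ 0
  hyp : ∀ x ∈ V, ∀ α : ℝ, 0 < α → M (fun _ => x + Complex.I • ((α : ℂ) • e)) ≠ 0

/-- The (auxiliary) hyperbolicity cone. -/
def garC0 {W : Type*} [AddCommGroup W] [Module ℂ W] {m : ℕ}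
    (M : MultilinearMap ℂ (fun _ : Fin m => W) ℂ) (V : Set W) (e : W) : Set W :=
  {z | z ∈ V ∧ ∀ t : ℝ, 0 ≤ t → M (fun _ => z + (t : ℂ) • e) ≠ 0}

/-- The open hyperbolicity cone. -/
def garC {W : Type*} [AddCommGroup W] [Module ℂ W] {m : ℕ}
    (M : MultilinearMap ℂ (fun _ : Fin m => W) ℂ) (V : Set W) (e : W) : Set W :=
  {z | ∃ z₀ ∈ garC0 M V e, ∃ δ : ℝ, 0 < δ ∧ z = z₀ + (δ : ℂ) • e}

theorem garC0_extend {W : Type*} [AddCommGroup W] [Module ℂ W] [TopologicalSpace W]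
    [ContinuousAdd W] [ContinuousSMul ℂ W] {m : ℕ}
    {M : MultilinearMap ℂ (fun _ : Fin m => W) ℂ} {V : Set W} {e : W} (h : GarHyp M V e)
    {y z : W} (hy : ∀ s : ℝ, 0 ≤ s → s ≤ 1 → ∀ x ∈ V, ∀ α : ℝ, 0 < α →
      M (fun _ => x + Complex.I • ((α : ℂ) • e + (s : ℂ) • y)) ≠ 0)
    (hz : z ∈ garC0 M V e) {x : W} (hx : x ∈ V) {α : ℝ} (hα : 0 < α) :
    M (fun _ => x + Complex.I • ((α : ℂ) • e + y + z)) ≠ 0 := by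
  have hz0 : M (fun _ => z) ≠ 0 := by simpa using hz.2 0 le_rfl
  have key := gar_homotopy M h.cont (x + Complex.I • y) (Complex.I • ((α : ℂ) • e)) z hz0 ?_ ?_
  · intro h0
    have := key Complex.I (by
      rw [← h0]; congr 1; funext _; simp only [smul_add]; abel)
    simp at this
    linarith
  · intro s t
    have := hy s s.2.1 s.2.2 (((s : ℝ) : ℂ) • x + (t : ℂ) • z)
      (h.vadd _ (h.vsmul _ _ hx) _ (h.vsmul _ _ hz.1)) α hα
    intro h0
    apply this
    rw [← h0]; congr 1; funext _
    simp only [smul_add, smul_smul, mul_comm Complex.I]; abel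
  · intro t ht
    have ht0 : t ≠ 0 := by
      rintro rfl
      apply h.hyp ((0 : ℝ) • (0 : ℂ) • e) (by simpa using h.vsmul 0 e h.mem) α hα
      rw [← ht]; simp
    have h1 : M (fun _ => z + (t⁻¹ * (Complex.I * α)) • e) = 0 := by
      have h2 : (fun _ : Fin m => z + (t⁻¹ * (Complex.I * α)) • e) =
          fun _ => t⁻¹ • (Complex.I • ((α : ℂ) • e) + t • z) := by
        funext _
        rw [smul_add, smul_smul t⁻¹ t, inv_mul_cancel₀ ht0, one_smul, smul_smul, smul_smul,
          add_comm, mul_assoc]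
      rw [h2, gar_smul, ht, mul_zero]
    obtain ⟨him, hre⟩ := gar_root_real h.vadd h.vsmul h.mem h.hyp hz.1 hz.2 h1
    have hN : 0 < Complex.normSq t := Complex.normSq_pos.2 ht0
    simp [Complex.inv_re, Complex.inv_im] at hre
    have h3 : t.im / Complex.normSq t * α < 0 := by
      simpa [neg_div] using hre
    have h4 : t.im / Complex.normSq t < 0 := by
      by_contra hcon
      push Not at hcon
      nlinarith [mul_nonneg hcon hα.le]
    by_contra hcon
    push Not at hcon
    have := div_nonneg hcon hN.le
    linarith

theorem garC0_stab {W : Type*} [AddCommGroup W] [Module ℂ W] [TopologicalSpace W]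
    [ContinuousAdd W] [ContinuousSMul ℂ W] {m : ℕ}
    {M : MultilinearMap ℂ (fun _ : Fin m => W) ℂ} {V : Set W} {e : W} (h : GarHyp M V e)
    {z : W} (hz : z ∈ garC0 M V e) {x : W} (hx : x ∈ V) {α : ℝ} (hα : 0 < α) :
    M (fun _ => x + Complex.I • ((α : ℂ) • e + z)) ≠ 0 := by
  have := garC0_extend h (y := 0) (fun s _ _ x hx α hα => by simpa using h.hyp x hx α hα) hz hx hα
  simpa using this

theorem garC0_smul {W : Type*} [AddCommGroup W] [Module ℂ W] [TopologicalSpace W]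
    {m : ℕ} {M : MultilinearMap ℂ (fun _ : Fin m => W) ℂ} {V : Set W} {e : W} (h : GarHyp M V e)
    {z : W} (hz : z ∈ garC0 M V e) {s : ℝ} (hs : 0 < s) : (s : ℂ) • z ∈ garC0 M V e := by
  refine ⟨h.vsmul _ _ hz.1, fun t ht h0 => ?_⟩
  have hs' : (s : ℂ) ≠ 0 := by exact_mod_cast hs.ne'
  have h1 : (fun _ : Fin m => (s : ℂ) • z + (t : ℂ) • e) =
      fun _ => (s : ℂ) • (z + ((t / s : ℝ) : ℂ) • e) := by
    funext _
    rw [smul_add, smul_smul]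
    congr 2
    push_cast
    field_simp
  rw [h1, gar_smul, mul_eq_zero, or_iff_right (pow_ne_zero _ hs')] at h0
  exact hz.2 _ (div_nonneg ht hs.le) h0

theorem garC0_stab_add {W : Type*} [AddCommGroup W] [Module ℂ W] [TopologicalSpace W]
    [ContinuousAdd W] [ContinuousSMul ℂ W] {m : ℕ}
    {M : MultilinearMap ℂ (fun _ : Fin m => W) ℂ} {V : Set W} {e : W} (h : GarHyp M V e)
    {y z : W} (hy : y ∈ garC0 M V e) (hz : z ∈ garC0 M V e) {α : ℝ} (hα : 0 < α) :
    M (fun _ => (y + z) + (α : ℂ) • e) ≠ 0 := by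
  have h0 : (0 : W) ∈ V := by simpa using h.vsmul 0 e h.mem
  have := garC0_extend h (y := y) (fun s hs _ x hx α hα => by
    rcases hs.eq_or_lt with h1 | h1
    · rw [← h1]; simpa using h.hyp x hx α hα
    · exact garC0_stab h (garC0_smul h hy h1) hx hα) hz h0 hα
  intro hcon
  apply this
  have h1 : (fun _ : Fin m => (0 : W) + Complex.I • ((α : ℂ) • e + y + z)) =
      fun _ => Complex.I • ((y + z) + (α : ℂ) • e) := by
    funext _; rw [zero_add]; congr 1; abel
  rw [h1, gar_smul, hcon, mul_zero]

theorem garC_cone {W : Type*} [AddCommGroup W] [Module ℂ W] [TopologicalSpace W]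
    [ContinuousAdd W] [ContinuousSMul ℂ W] {m : ℕ}
    {M : MultilinearMap ℂ (fun _ : Fin m => W) ℂ} {V : Set W} {e : W} (h : GarHyp M V e) :
    GarCone V (garC M V e) where
  vadd := h.vadd
  vsmul := h.vsmul
  sub := by
    rintro z ⟨z₀, hz₀, δ, hδ, rfl⟩
    exact h.vadd _ hz₀.1 _ (h.vsmul _ _ h.mem)
  cadd := by
    rintro y ⟨y₀, hy₀, δ, hδ, rfl⟩ z ⟨z₀, hz₀, ε, hε, rfl⟩
    refine ⟨(y₀ + z₀) + (δ : ℂ) • e, ⟨h.vadd _ (h.vadd _ hy₀.1 _ hz₀.1) _ (h.vsmul _ _ h.mem),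
      fun t ht => ?_⟩, ε, hε, by abel⟩
    have := garC0_stab_add h hy₀ hz₀ (α := δ + t) (by linarith)
    convert this using 3
    push_cast
    rw [add_smul]; abel
  csmul := by
    rintro s hs z ⟨z₀, hz₀, δ, hδ, rfl⟩
    refine ⟨(s : ℂ) • z₀, garC0_smul h hz₀ hs, s * δ, by positivity, ?_⟩
    push_cast
    rw [smul_add, smul_smul]

theorem garC_stab {W : Type*} [AddCommGroup W] [Module ℂ W] [TopologicalSpace W]
    [ContinuousAdd W] [ContinuousSMul ℂ W] {m : ℕ}
    {M : MultilinearMap ℂ (fun _ : Fin m => W) ℂ} {V : Set W} {e : W} (h : GarHyp M V e) :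
    garStab M V (garC M V e) := by
  rintro x hx z ⟨z₀, hz₀, δ, hδ, rfl⟩
  rw [add_comm z₀]
  exact garC0_stab h hz₀ hx hδ

theorem garC_pos {W : Type*} [AddCommGroup W] [Module ℂ W] [TopologicalSpace W]
    {m : ℕ} {M : MultilinearMap ℂ (fun _ : Fin m => W) ℂ} {V : Set W} {e : W} (h : GarHyp M V e)
    {c : ℝ} (hc : 0 < c) (hce : M (fun _ => e) = c) :
    ∀ y ∈ garC M V e, ∃ p : ℝ, 0 < p ∧ M (fun _ => y) = p := by
  rintro z ⟨z₀, hz₀, δ, hδ, rfl⟩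
  obtain ⟨l, hl, hr⟩ := gar_factor_real h.vadd h.vsmul h.mem h.hyp h.ne hz₀.1 hz₀.2
  refine ⟨c * ∏ i, (δ + l i), mul_pos hc (Finset.prod_pos fun i _ => add_pos hδ (hl i)), ?_⟩
  rw [hr, hce]
  push_cast
  simp

theorem gar_polar {W : Type*} [AddCommGroup W] [Module ℂ W] {m : ℕ}
    (M : MultilinearMap ℂ (fun _ : Fin m => W) ℂ) (hS : garSymm M) (A : Fin m → W) :
    ∑ T : Finset (Fin m), (-1 : ℂ) ^ (m - T.card) * M (fun _ => ∑ j ∈ T, A j) =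
      m.factorial * M A := by
  have h1 : ∀ T : Finset (Fin m), M (fun _ => ∑ j ∈ T, A j) =
      ∑ f : Fin m → Fin m, if Finset.univ.image f ⊆ T then M (fun i => A (f i)) else 0 := by
    intro T
    rw [MultilinearMap.map_sum_finset M (fun _ j => A j) (fun _ => T), ← Finset.sum_filter]
    refine Finset.sum_congr ?_ fun _ _ => rfl
    ext f
    simp [Finset.image_subset_iff]
  have h2 : ∀ B : Finset (Fin m), ∑ T : Finset (Fin m),
      (if B ⊆ T then (-1 : ℂ) ^ (m - T.card) else 0) = if B = Finset.univ then 1 else 0 := by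
    intro B
    have h3 := Finset.sum_powerset_neg_one_pow_card (x := Bᶜ)
    simp only [Finset.compl_eq_empty_iff] at h3
    have h4 : (∑ U ∈ Bᶜ.powerset, (-1 : ℂ) ^ U.card) = if B = Finset.univ then 1 else 0 := by
      exact_mod_cast congrArg (Int.cast : ℤ → ℂ) h3
    rw [← h4, ← Finset.sum_filter]
    refine Finset.sum_nbij' (fun T => Tᶜ) (fun T => Tᶜ) ?_ ?_ ?_ ?_ ?_
    · intro T hT
      simpa using hT
    · intro T hT
      simp only [Finset.mem_powerset] at hT
      simp only [Finset.mem_filter, Finset.mem_univ, true_and]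
      exact Finset.subset_compl_comm.1 hT
    · simp
    · simp
    · intro T _
      rw [Finset.card_compl, Fintype.card_fin]
  simp_rw [h1, Finset.mul_sum]
  rw [Finset.sum_comm]
  have h5 : ∀ f : Fin m → Fin m, ∑ T : Finset (Fin m), (-1 : ℂ) ^ (m - T.card) *
      (if Finset.univ.image f ⊆ T then M (fun i => A (f i)) else 0) =
      if Function.Bijective f then M A else 0 := by
    intro f
    have h6 : ∀ T : Finset (Fin m), (-1 : ℂ) ^ (m - T.card) *
      (if Finset.univ.image f ⊆ T then M (fun i => A (f i)) else 0) =
      (if Finset.univ.image f ⊆ T then (-1 : ℂ) ^ (m - T.card) else 0) * M (fun i => A (f i)) := by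
      intro T; split_ifs <;> simp
    simp_rw [h6]
    rw [← Finset.sum_mul, h2]
    have h7 : Finset.univ.image f = Finset.univ ↔ Function.Bijective f := by
      rw [← Finite.surjective_iff_bijective, Finset.eq_univ_iff_forall]
      simp [Function.Surjective]
    by_cases hf : Function.Bijective f
    · rw [if_pos (h7.2 hf), if_pos hf, one_mul]
      exact hS (Equiv.ofBijective f hf) A
    · rw [if_neg (fun h => hf (h7.1 h)), if_neg hf, zero_mul]
  simp_rw [h5]
  rw [← Finset.sum_filter, Finset.sum_const, nsmul_eq_mul]
  congr 2
  rw [← Fintype.card_subtype, ← Fintype.card_congr (Equiv.ofBijective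
    (fun σ : Equiv.Perm (Fin m) => (⟨σ, σ.bijective⟩ : {f : Fin m → Fin m // Function.Bijective f}))
    ⟨fun σ τ h => by
      apply Equiv.ext; intro i
      exact congrFun (congrArg Subtype.val h) i, fun f => ⟨Equiv.ofBijective f.1 f.2, rfl⟩⟩),
    Fintype.card_perm, Fintype.card_fin]

/-- Row `i` of a matrix as a linear map. -/
def garRow (n : ℕ) (i : Fin n) : Matrix (Fin n) (Fin n) ℂ →ₗ[ℂ] (Fin n → ℂ) where
  toFun A := A i
  map_add' _ _ := rfl
  map_smul' _ _ := rfl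

/-- The mixed discriminant. -/
noncomputable def garDet (n : ℕ) :
    MultilinearMap ℂ (fun _ : Fin n => Matrix (Fin n) (Fin n) ℂ) ℂ :=
  ((n.factorial : ℂ)⁻¹) • ∑ π : Equiv.Perm (Fin n),
    MultilinearMap.domDomCongr π
      ((Matrix.detRowAlternating (n := Fin n) (R := ℂ)).toMultilinearMap.compLinearMap (garRow n))

theorem garDet_apply (n : ℕ) (A : Fin n → Matrix (Fin n) (Fin n) ℂ) :
    garDet n A = ((n.factorial : ℂ)⁻¹) * ∑ π : Equiv.Perm (Fin n),
      Matrix.det (fun i j => A (π i) i j) := by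
  simp only [garDet, smul_apply, smul_eq_mul, sum_apply]
  rfl

theorem garDet_diag (n : ℕ) (A : Matrix (Fin n) (Fin n) ℂ) : garDet n (fun _ => A) = A.det := by
  rw [garDet_apply]
  simp only [Finset.sum_const, Finset.card_univ, Fintype.card_perm, Fintype.card_fin, nsmul_eq_mul]
  rw [← mul_assoc, inv_mul_cancel₀ (by exact_mod_cast n.factorial_ne_zero), one_mul]

theorem garDet_symm (n : ℕ) : garSymm (garDet n) := by
  intro σ v
  rw [garDet_apply, garDet_apply]
  congr 1
  exact Fintype.sum_equiv (Equiv.mulLeft σ) _ _ (fun π => rfl)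

theorem garDet_cont (n : ℕ) :
    Continuous fun w : Fin n → Matrix (Fin n) (Fin n) ℂ => garDet n w := by
  simp_rw [garDet_apply]
  refine continuous_const.mul (continuous_finsetSum _ fun π _ => ?_)
  refine Continuous.matrix_det ?_
  refine continuous_pi fun i => continuous_pi fun j => ?_
  exact (continuous_apply j).comp ((continuous_apply i).comp (continuous_apply (π i)))

/-- `∏ (X + λ_i)`. -/
noncomputable def garPoly {n : ℕ} {A : Matrix (Fin n) (Fin n) ℂ} (hA : A.IsHermitian) :
    Polynomial ℝ := ∏ i, (Polynomial.X + Polynomial.C (hA.eigenvalues i))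

theorem garPoly_coeff {n : ℕ} {A : Matrix (Fin n) (Fin n) ℂ} (hA : A.IsHermitian) {k : ℕ}
    (hk : k ≤ n) : (garPoly hA).coeff k = sigmaH hA (n - k) := by
  rw [garPoly, Finset.prod_X_add_C_coeff _ _ (by simpa using hk)]
  simp [sigmaH]

theorem garDet_line {n : ℕ} {A : Matrix (Fin n) (Fin n) ℂ} (hA : A.IsHermitian) (t : ℂ) :
    (A + t • (1 : Matrix (Fin n) (Fin n) ℂ)).det =
      ((garPoly hA).map Complex.ofRealHom).eval t := by
  have h := hA.charpoly_eq
  have h1 := congrArg (Polynomial.eval (-t)) h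
  rw [Matrix.eval_charpoly] at h1
  have h2 : A + t • (1 : Matrix (Fin n) (Fin n) ℂ) = - (Matrix.scalar (Fin n) (-t) - A) := by
    rw [map_neg, Matrix.smul_one_eq_diagonal, Matrix.scalar_apply, neg_sub, sub_neg_eq_add]
  rw [h2, Matrix.det_neg, h1, garPoly]
  have h3 : ((-1 : ℂ)) ^ Fintype.card (Fin n) = ∏ _i : Fin n, (-1 : ℂ) := by simp
  rw [h3, Polynomial.eval_prod, Polynomial.map_prod, Polynomial.eval_prod,
    ← Finset.prod_mul_distrib]
  refine Finset.prod_congr rfl fun i _ => ?_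
  simp
  ring

def garHerm (n : ℕ) : Set (Matrix (Fin n) (Fin n) ℂ) := {A | A.IsHermitian}

def garRay (n : ℕ) : Set (Matrix (Fin n) (Fin n) ℂ) :=
  {A | ∃ α : ℝ, 0 < α ∧ A = (α : ℂ) • 1}

theorem garHerm_add (n : ℕ) : ∀ x ∈ garHerm n, ∀ y ∈ garHerm n, x + y ∈ garHerm n :=
  fun _ hx _ hy => Matrix.IsHermitian.add hx hy

theorem garHerm_smul (n : ℕ) : ∀ r : ℝ, ∀ x ∈ garHerm n, (r : ℂ) • x ∈ garHerm n := by
  intro r x hx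
  have hx' : x.conjTranspose = x := hx
  change ((r : ℂ) • x).conjTranspose = _
  rw [Matrix.conjTranspose_smul, hx']
  simp

theorem garHerm_one (n : ℕ) : (1 : Matrix (Fin n) (Fin n) ℂ) ∈ garHerm n :=
  Matrix.isHermitian_one

theorem garRay_cone (n : ℕ) : GarCone (garHerm n) (garRay n) where
  vadd := garHerm_add n
  vsmul := garHerm_smul n
  sub := by
    rintro _ ⟨α, hα, rfl⟩
    exact garHerm_smul n _ _ (garHerm_one n)
  cadd := by
    rintro _ ⟨α, hα, rfl⟩ _ ⟨β, hβ, rfl⟩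
    exact ⟨α + β, by positivity, by push_cast; rw [add_smul]⟩
  csmul := by
    rintro r hr _ ⟨α, hα, rfl⟩
    exact ⟨r * α, by positivity, by push_cast; rw [smul_smul]⟩

theorem garRay_one (n : ℕ) : (1 : Matrix (Fin n) (Fin n) ℂ) ∈ garRay n := ⟨1, one_pos, by simp⟩

theorem garDet_stab (n : ℕ) : garStab (garDet n) (garHerm n) (garRay n) := by
  rintro x hx _ ⟨α, hα, rfl⟩
  have hx' : x.IsHermitian := hx
  rw [garDet_diag, smul_smul, garDet_line hx', garPoly, Polynomial.map_prod, Polynomial.eval_prod]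
  refine Finset.prod_ne_zero_iff.2 fun i _ h => ?_
  have := congrArg Complex.im h
  simp at this
  linarith

theorem gar_level (n : ℕ) : ∀ k m : ℕ, m + k = n →
    ∃ M : MultilinearMap ℂ (fun _ : Fin m => Matrix (Fin n) (Fin n) ℂ) ℂ,
      garSymm M ∧ (Continuous fun w : Fin m → Matrix (Fin n) (Fin n) ℂ => M w) ∧
      garStab M (garHerm n) (garRay n) ∧ ∃ c : ℝ, 0 < c ∧
      ∀ (A : Matrix (Fin n) (Fin n) ℂ) (hA : A.IsHermitian) (t : ℂ),
        M (fun _ => A + t • (1 : Matrix (Fin n) (Fin n) ℂ)) =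
          c * ((Polynomial.derivative^[k] (garPoly hA)).map Complex.ofRealHom).eval t := by
  intro k
  induction k with
  | zero =>
    intro m hm
    have : m = n := by omega
    subst this
    refine ⟨garDet m, garDet_symm m, garDet_cont m, garDet_stab m, 1, one_pos, fun A hA t => ?_⟩
    rw [garDet_diag, garDet_line hA]
    simp
  | succ k ih =>
    intro m hm
    obtain ⟨M, hS, hc, hst, c, hcpos, hev⟩ := ih (m + 1) (by omega)
    refine ⟨M.curryLeft 1, garSymm_curryLeft hS _, ?_,
      garStab_curryLeft (garRay_cone n) hS hst (garRay_one n), c / (m + 1), by positivity, ?_⟩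
    · simp only [MultilinearMap.curryLeft_apply]
      refine hc.comp (continuous_pi fun i => ?_)
      refine Fin.cases ?_ (fun j => ?_) i
      · simpa using continuous_const
      · simpa using continuous_apply j
    · intro A hA t
      have h1 := gar_hasDerivAt M hS A 1 t
      have h2 := (((Polynomial.derivative^[k] (garPoly hA)).map Complex.ofRealHom).hasDerivAt
        t).const_mul (c : ℂ)
      have h3 := h1.unique (h2.congr_of_eventuallyEq (Filter.Eventually.of_forall (hev A hA)))
      have hne : (m : ℂ) + 1 ≠ 0 := by exact_mod_cast Nat.succ_ne_zero m
      rw [MultilinearMap.curryLeft_apply, Function.iterate_succ_apply', ← Polynomial.derivative_map]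
      push_cast
      field_simp
      rw [mul_comm, h3]

theorem gar_pos {n k m : ℕ} (hmk : m + k = n) {A : Matrix (Fin n) (Fin n) ℂ} (hA : A.IsHermitian)
    (hσ : ∀ k, 1 ≤ k → k ≤ m → 0 ≤ sigmaH hA k) {t : ℝ} (ht : 0 < t) :
    0 < (Polynomial.derivative^[k] (garPoly hA)).eval t := by
  have hσ' : ∀ j, j ≤ m → 0 ≤ sigmaH hA j := by
    intro j hj
    rcases Nat.eq_zero_or_pos j with rfl | h
    · simp [sigmaH]
    · exact hσ j h hj
  have hdeg : (garPoly hA).natDegree ≤ n := by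
    refine (Polynomial.natDegree_prod_le _ _).trans ?_
    refine (Finset.sum_le_card_nsmul _ _ 1 fun i _ => ?_).trans (by simp)
    exact (Polynomial.natDegree_X_add_C _).le
  have hdeg2 : (Polynomial.derivative^[k] (garPoly hA)).natDegree < m + 1 := by
    have := Polynomial.natDegree_iterate_derivative (garPoly hA) k
    omega
  rw [Polynomial.eval_eq_sum_range' hdeg2]
  have hco : ∀ j, j ≤ m → (Polynomial.derivative^[k] (garPoly hA)).coeff j =
      (j + k).descFactorial k * sigmaH hA (m - j) := by
    intro j hj
    rw [Polynomial.coeff_iterate_derivative, garPoly_coeff hA (by omega), nsmul_eq_mul]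
    congr 2
    omega
  refine Finset.sum_pos' (fun j hj => ?_) ⟨m, by simp, ?_⟩
  · rw [Finset.mem_range] at hj
    rw [hco j (by omega)]
    have := hσ' (m - j) (by omega)
    positivity
  · rw [hco m le_rfl]
    have h1 : 0 < (m + k).descFactorial k := Nat.descFactorial_pos.2 (by omega)
    have h2 : sigmaH hA (m - m) = 1 := by simp [sigmaH]
    rw [h2]
    positivity

open scoped ComplexOrder in
theorem gar_zero_eig {n : ℕ} (h0 : (0 : Matrix (Fin n) (Fin n) ℂ).IsHermitian) (i : Fin n) :
    0 ≤ h0.eigenvalues i :=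
  Matrix.PosSemidef.zero.eigenvalues_nonneg i

/-- Mixed Gårding inequality for Hermitian matrices: if `σ_k(A_j) ≥ 0` for all
`k = 1,…,m` and `j = 1,…,m`, then `D_m(A₁,…,A_m)^m ≥ σ_m(A₁) ⋯ σ_m(A_m)`. -/
theorem mixed_garding_hermitian {n m : ℕ} (hn : 1 ≤ n) (hm : 1 ≤ m) (hmn : m ≤ n)
    (A : Fin m → Matrix (Fin n) (Fin n) ℂ) (hA : ∀ j, (A j).IsHermitian)
    (hσ : ∀ j, ∀ k, 1 ≤ k → k ≤ m → 0 ≤ sigmaH (hA j) k) :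
    Dpol A hA ^ m ≥ ∏ j, sigmaH (hA j) m := by
  obtain ⟨k, hk⟩ := Nat.exists_eq_add_of_le hmn
  obtain ⟨M, hS, hcont, hst, c, hc, hev⟩ := gar_level n k m hk.symm
  have hline : ∀ (B : Matrix (Fin n) (Fin n) ℂ) (hB : B.IsHermitian) (t : ℝ),
      M (fun _ => B + (t : ℂ) • (1 : Matrix (Fin n) (Fin n) ℂ)) =
        ((c * (Polynomial.derivative^[k] (garPoly hB)).eval t : ℝ) : ℂ) := by
    intro B hB t
    rw [hev B hB]
    push_cast
    congr 1
    rw [Polynomial.eval_map]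
    exact Polynomial.eval₂_at_apply Complex.ofRealHom t
  -- value on the diagonal
  set d : ℝ := c * k.factorial with hd
  have hdpos : 0 < d := by positivity
  have hdiag : ∀ (B : Matrix (Fin n) (Fin n) ℂ) (hB : B.IsHermitian),
      M (fun _ => B) = ((d * sigmaH hB m : ℝ) : ℂ) := by
    intro B hB
    have := hline B hB 0
    simp only [Complex.ofReal_zero, zero_smul, add_zero] at this
    rw [this, ← Polynomial.coeff_zero_eq_eval_zero, Polynomial.coeff_iterate_derivative,
      garPoly_coeff hB (by omega), zero_add, Nat.descFactorial_self, nsmul_eq_mul]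
    have : n - k = m := by omega
    rw [this, hd, mul_assoc]
  -- polarization
  have hpol : M A = ((d * Dpol A hA : ℝ) : ℂ) := by
    have h1 := gar_polar M hS A
    have hfac : (m.factorial : ℂ) ≠ 0 := by exact_mod_cast m.factorial_ne_zero
    have h2 : M A = (m.factorial : ℂ)⁻¹ *
        ∑ T : Finset (Fin m), (-1 : ℂ) ^ (m - T.card) * M (fun _ => ∑ j ∈ T, A j) := by
      rw [h1, ← mul_assoc, inv_mul_cancel₀ hfac, one_mul]
    rw [h2, Dpol, ← Finset.sum_filter_add_sum_filter_not Finset.univ (fun T => T ≠ ∅)]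
    have h3 : ∑ T ∈ (Finset.univ : Finset (Finset (Fin m))).filter (fun T => ¬ T ≠ ∅),
        (-1 : ℂ) ^ (m - T.card) * M (fun _ => ∑ j ∈ T, A j) = 0 := by
      refine Finset.sum_eq_zero fun T hT => ?_
      have hT' : T = ∅ := by simpa using hT
      subst hT'
      rw [M.map_coord_zero ⟨0, hm⟩ (by simp), mul_zero]
    rw [h3, add_zero]
    have h4 : ∀ T : Finset (Fin m), M (fun _ => ∑ j ∈ T, A j) =
      ((d * sigmaH (isHermitian_finsetSum A hA T) m : ℝ) : ℂ) := fun T => hdiag _ _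
    simp_rw [h4]
    push_cast
    rw [mul_left_comm (d : ℂ)]
    refine congrArg ((m.factorial : ℂ)⁻¹ * ·) ?_
    rw [Finset.mul_sum]
    refine Finset.sum_congr rfl fun T _ => ?_
    ring
  -- hyperbolicity
  have hH : GarHyp M (garHerm n) 1 :=
    { cont := hcont
      vadd := garHerm_add n
      vsmul := garHerm_smul n
      mem := garHerm_one n
      ne := garStab_ne (garRay_cone n) hst (garRay_one n)
      hyp := fun x hx α hα => hst x hx _ ⟨α, hα, rfl⟩ }
  have hone : ∃ c1 : ℝ, 0 < c1 ∧ M (fun _ => 1) = c1 := by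
    have h0 : (0 : Matrix (Fin n) (Fin n) ℂ).IsHermitian := Matrix.isHermitian_zero
    have h := hline 0 h0 1
    simp only [Complex.ofReal_one, one_smul, zero_add] at h
    refine ⟨_, mul_pos hc (gar_pos hk.symm h0 (fun j _ _ => ?_) one_pos), h⟩
    refine Finset.sum_nonneg fun S _ => Finset.prod_nonneg fun i _ => ?_
    exact gar_zero_eig h0 i
  obtain ⟨c1, hc1, h1⟩ := hone
  have hmem : ∀ j, ∀ ε : ℝ, 0 < ε → A j + (ε : ℂ) • 1 ∈ garC M (garHerm n) 1 := by
    intro j ε hε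
    refine ⟨A j + ((ε / 2 : ℝ) : ℂ) • 1, ⟨garHerm_add n _ (hA j) _
      (garHerm_smul n _ _ (garHerm_one n)), fun t ht => ?_⟩, ε / 2, by positivity, ?_⟩
    · rw [add_assoc, ← add_smul, ← Complex.ofReal_add, hline _ (hA j)]
      have := mul_pos hc (gar_pos hk.symm (hA j) (hσ j) (t := ε / 2 + t) (by positivity))
      exact_mod_cast this.ne'
    · rw [add_assoc, ← add_smul, ← Complex.ofReal_add, add_halves]
  obtain ⟨m, rfl⟩ : ∃ m', m = m' + 1 := ⟨m - 1, by omega⟩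
  have hineq : ∀ ε : ℝ, 0 < ε →
      ∏ j, (M (fun _ => A j + (ε : ℂ) • 1)).re ≤ (M (fun j => A j + (ε : ℂ) • 1)).re ^ (m + 1) := by
    intro ε hε
    obtain ⟨s, hs, h2, h3⟩ := gar_mixed (garC_cone hH) M hS (garC_stab hH) (garC_pos hH hc1 h1)
      (fun j => A j + (ε : ℂ) • 1) (fun j => hmem j ε hε)
    rw [h2]
    exact h3
  have hcl : Continuous fun ε : ℝ => ∏ j, (M (fun _ => A j + (ε : ℂ) • 1)).re := by
    refine continuous_finsetProd _ fun j _ => Complex.continuous_re.comp (hcont.comp ?_)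
    refine continuous_pi fun _ => ?_
    fun_prop
  have hcr : Continuous fun ε : ℝ => (M (fun j => A j + (ε : ℂ) • 1)).re ^ (m + 1) := by
    refine (Complex.continuous_re.comp (hcont.comp ?_)).pow _
    refine continuous_pi fun _ => ?_
    fun_prop
  have hlim := le_of_tendsto_of_tendsto (b := nhdsWithin (0 : ℝ) (Set.Ioi 0))
    ((hcl.tendsto 0).mono_left nhdsWithin_le_nhds) ((hcr.tendsto 0).mono_left nhdsWithin_le_nhds)
    (by filter_upwards [self_mem_nhdsWithin] with ε hε using hineq ε hε)
  simp only [Complex.ofReal_zero, zero_smul, add_zero] at hlim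
  rw [hpol, Complex.ofReal_re, mul_pow] at hlim
  have hprod : ∏ j, (M (fun _ => A j)).re = d ^ (m + 1) * ∏ j, sigmaH (hA j) (m + 1) := by
    simp_rw [fun j => hdiag (A j) (hA j), Complex.ofReal_re]
    rw [Finset.prod_mul_distrib]
    simp
  rw [hprod] at hlim
  exact le_of_mul_le_mul_left hlim (by positivity)
end
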